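/- Let 𝐟 : ℝ² → ℝ be a C² function on the open unit disk D = {(u,v) : u² + v² < 1} satisfying the minimal surface equation on D. Suppose there exists a unit vector h = (h₁,h₂) ∈ ℝ² such that ∇_h𝐟(0,0) = 0 and ∇²_{h,ih}𝐟(0,0) = 0, where ih = (−h₂, h₁). Let W² = 1 + (∂_u𝐟(0,0))² + (∂_v𝐟(0,0))² and let K be the Gaussian curvature of the graph of 𝐟 at the point above the origin. Then W² |K| < π²/2. -/

import Mathlib

open Real Set

/-- Partial derivative in the `u` (first coordinate) direction. -/
noncomputable def pdu (f : ℝ × ℝ → ℝ) (p : ℝ × ℝ) : ℝ := lineDeriv ℝ f p (1, 0)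

/-- Partial derivative in the `v` (second coordinate) direction. -/
noncomputable def pdv (f : ℝ × ℝ → ℝ) (p : ℝ × ℝ) : ℝ := lineDeriv ℝ f p (0, 1)

/-- The open unit disk in `ℝ²`. -/
def unitDisk : Set (ℝ × ℝ) := {p | p.1 ^ 2 + p.2 ^ 2 < 1}

/-- The Gaussian curvature of the graph of `f` at the point above `p`. -/
noncomputable def gaussCurv (f : ℝ × ℝ → ℝ) (p : ℝ × ℝ) : ℝ :=
  (pdu (pdu f) p * pdv (pdv f) p - (pdv (pdu f) p) ^ 2) /
    (1 + (pdu f p) ^ 2 + (pdv f p) ^ 2) ^ 2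

/-- `f` satisfies the minimal surface equation on `D`. -/
def MinimalSurfaceEq (f : ℝ × ℝ → ℝ) (D : Set (ℝ × ℝ)) : Prop :=
  ∀ p ∈ D, (1 + (pdv f p) ^ 2) * pdu (pdu f) p
      - 2 * pdu f p * pdv f p * pdv (pdu f) p
      + (1 + (pdu f p) ^ 2) * pdv (pdv f) p = 0

/-- `ζ` is an `h`-symmetric point of `f`: `h` is a unit vector,
`∇ₕ f(ζ) = 0` and `∇²_{h, ih} f(ζ) = 0` where `ih = (-h₂, h₁)`. -/
def IsSymmetricPt (f : ℝ × ℝ → ℝ) (ζ : ℝ × ℝ) (h : ℝ × ℝ) : Prop :=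
  h.1 ^ 2 + h.2 ^ 2 = 1 ∧ lineDeriv ℝ f ζ h = 0 ∧
    lineDeriv ℝ (fun p => lineDeriv ℝ f p h) ζ (-h.2, h.1) = 0

section

open Filter Topology ComplexConjugate

/-- The real-linear map `y ↦ y - conj (c² y)`, the leading part of a harmonic function whose
second dilatation takes the value `-c²`. -/
noncomputable def twist (c : ℂ) : ℂ →L[ℝ] ℂ :=
  ContinuousLinearMap.id ℝ ℂ -
    (Complex.conjCLE : ℂ →L[ℝ] ℂ).comp ((ContinuousLinearMap.mul ℝ ℂ) (c ^ 2))

lemma twist_apply (c y : ℂ) : twist c y = y - conj (c ^ 2 * y) := by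
  simp [twist]

lemma twist_surjective {c : ℂ} (hc : ‖c‖ < 1) : Function.Surjective (twist c) := by
  have hinj : Function.Injective (twist c).toLinearMap := by
    rw [injective_iff_map_eq_zero]
    intro y hy
    have hy' : y = conj (c ^ 2 * y) := by
      have : twist c y = 0 := hy
      rwa [twist_apply, sub_eq_zero] at this
    have hn : ‖y‖ = ‖c‖ ^ 2 * ‖y‖ := by
      conv_lhs => rw [hy']
      simp
    by_contra hne
    have hpos : 0 < ‖y‖ := norm_pos_iff.mpr hne
    have : ‖c‖ ^ 2 < 1 := by nlinarith [norm_nonneg c]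
    nlinarith
  exact LinearMap.injective_iff_surjective.mp hinj

/-- Simultaneous factorization at a common zero of the two holomorphic parts of a harmonic
function with dilatation `-Q²`. -/
lemma exists_twist_factorization {G K Q : ℂ → ℂ} {z : ℂ} (hG : AnalyticAt ℂ G z)
    (hK : AnalyticAt ℂ K z) (hQ : AnalyticAt ℂ Q z) (hG0 : G z = 0) (hK0 : K z = 0)
    (hd : ∀ᶠ ζ in 𝓝 z, deriv K ζ = -(Q ζ) ^ 2 * deriv G ζ) {k : ℕ}
    (hk : analyticOrderAt G z = (k + 1 : ℕ)) :
    ∃ g r : ℂ → ℂ, AnalyticAt ℂ g z ∧ AnalyticAt ℂ r z ∧ g z ≠ 0 ∧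
      ∀ᶠ ζ in 𝓝 z, G ζ = (ζ - z) ^ (k + 1) * g ζ ∧
        G ζ + conj (K ζ) = twist (Q z) ((ζ - z) ^ (k + 1) * g ζ) +
          conj ((ζ - z) ^ (k + 2) * r ζ) := by
  obtain ⟨g, hg, hgz, hGg⟩ := hG.analyticOrderAt_eq_natCast.mp hk
  set L : ℂ → ℂ := fun ζ => K ζ + Q z ^ 2 * G ζ with hLdef
  have hL : AnalyticAt ℂ L z := by fun_prop
  have hdL : deriv L =ᶠ[𝓝 z] fun ζ => (Q z ^ 2 - Q ζ ^ 2) * deriv G ζ := by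
    filter_upwards [hd, hG.eventually_analyticAt, hK.eventually_analyticAt] with ζ h1 h2 h3
    have : HasDerivAt L (deriv K ζ + Q z ^ 2 * deriv G ζ) ζ :=
      h3.differentiableAt.hasDerivAt.add (h2.differentiableAt.hasDerivAt.const_mul _)
    rw [this.deriv, h1]; ring
  have hGd : analyticOrderAt (deriv G) z = k :=
    (analyticOrderAt_deriv_eq_iff hG hG0).mp (by simpa using hk)
  have hQ1 : (1 : ℕ∞) ≤ analyticOrderAt (fun ζ => Q z ^ 2 - Q ζ ^ 2) z := by
    rw [Order.one_le_iff_ne_zero, AnalyticAt.analyticOrderAt_ne_zero (by fun_prop)]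
    ring
  have hLd : ((k + 1 : ℕ) : ℕ∞) ≤ analyticOrderAt (deriv L) z := by
    rw [analyticOrderAt_congr hdL]
    have := analyticOrderAt_mul (f := fun ζ => Q z ^ 2 - Q ζ ^ 2) (by fun_prop) hG.deriv
    have h2 : (fun ζ => (Q z ^ 2 - Q ζ ^ 2) * deriv G ζ) =
      (fun ζ => Q z ^ 2 - Q ζ ^ 2) * deriv G := rfl
    rw [h2, this, hGd, Nat.cast_add, add_comm, Nat.cast_one]
    gcongr
  have hL2 : ((k + 2 : ℕ) : ℕ∞) ≤ analyticOrderAt L z := by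
    exact_mod_cast (analyticOrderAt_deriv_ge_iff hL (by simp [hLdef, hG0, hK0])).mp hLd
  obtain ⟨r, hr, hLr⟩ := (natCast_le_analyticOrderAt hL).mp hL2
  refine ⟨g, r, hg, hr, hgz, ?_⟩
  filter_upwards [hGg, hLr] with ζ h1 h2
  refine ⟨by simpa using h1, ?_⟩
  have hKζ : K ζ = (ζ - z) ^ (k + 2) * r ζ - Q z ^ 2 * G ζ := by
    have : K ζ + Q z ^ 2 * G ζ = (ζ - z) ^ (k + 2) * r ζ := by simpa [hLdef] using h2
    rw [← this]; ring
  have h1' : G ζ = (ζ - z) ^ (k + 1) * g ζ := by simpa using h1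
  rw [hKζ, twist_apply, ← h1', map_sub]
  ring

/-- The blow-up at scale `ε` of a harmonic function factored as in
`exists_twist_factorization`. -/
noncomputable def blowup (c z : ℂ) (g r : ℂ → ℂ) (k : ℕ) (x : ℝ × ℂ) : ℂ :=
  twist c (x.2 ^ k * g (z + x.1 * x.2)) + x.1 * conj (x.2 ^ (k + 1) * r (z + x.1 * x.2))

lemma pow_mul_blowup (c z : ℂ) (g r : ℂ → ℂ) (k : ℕ) (ε : ℝ) (η : ℂ) :
    (ε : ℂ) ^ k * blowup c z g r k (ε, η) =
      twist c ((z + ε * η - z) ^ k * g (z + ε * η)) +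
        conj ((z + ε * η - z) ^ (k + 1) * r (z + ε * η)) := by
  simp only [blowup, twist_apply, add_sub_cancel_left, mul_pow, map_mul, map_pow,
    Complex.conj_ofReal]
  ring

lemma contDiffAt_blowup {c z : ℂ} {g r : ℂ → ℂ} (hg : AnalyticAt ℂ g z) (hr : AnalyticAt ℂ r z)
    (k : ℕ) (η₀ : ℂ) : ContDiffAt ℝ 1 (blowup c z g r k) (0, η₀) := by
  have hin : ContDiffAt ℝ 1 (fun x : ℝ × ℂ => z + x.1 * x.2) (0, η₀) := by
    have h1 : ContDiff ℝ 1 (fun x : ℝ × ℂ => (x.1 : ℂ)) :=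
      Complex.ofRealCLM.contDiff.comp contDiff_fst
    have h2 : ContDiff ℝ 1 (fun x : ℝ × ℂ => x.2) := contDiff_snd
    exact (contDiff_const.add (h1.mul h2)).contDiffAt
  have h1 : ContDiffAt ℝ 1 (fun x : ℝ × ℂ => (x.1 : ℂ)) (0, η₀) :=
    (Complex.ofRealCLM.contDiff.comp contDiff_fst).contDiffAt
  have h2 : ContDiffAt ℝ 1 (fun x : ℝ × ℂ => x.2) (0, η₀) := contDiffAt_snd
  have hg' : ContDiffAt ℝ 1 (fun x : ℝ × ℂ => g (z + x.1 * x.2)) (0, η₀) := by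
    refine ContDiffAt.comp (g := g) (0, η₀) ?_ hin
    simpa using (hg.contDiffAt (n := 1)).restrict_scalars ℝ
  have hr' : ContDiffAt ℝ 1 (fun x : ℝ × ℂ => r (z + x.1 * x.2)) (0, η₀) := by
    refine ContDiffAt.comp (g := r) (0, η₀) ?_ hin
    simpa using (hr.contDiffAt (n := 1)).restrict_scalars ℝ
  have hc : ContDiffAt ℝ 1 (fun x : ℝ × ℂ => conj (x.2 ^ (k + 1) * r (z + x.1 * x.2)))
      (0, η₀) :=
    (Complex.conjCLE : ℂ →L[ℝ] ℂ).contDiff.contDiffAt.comp (0, η₀) ((h2.pow (k + 1)).mul hr')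
  exact ((twist c).contDiff.contDiffAt.comp (0, η₀) ((h2.pow k).mul hg')).add (h1.mul hc)

/-- Implicit function theorem for the blow-up perturbed by `V`. -/
lemma eventually_exists_blowup_add_eq_zero {c z : ℂ} (hc : ‖c‖ < 1) {g r : ℂ → ℂ}
    (hg : AnalyticAt ℂ g z) (hr : AnalyticAt ℂ r z) {k : ℕ} {η₀ e : ℂ} {V : ℝ × ℂ → ℂ}
    (hV : ContDiffAt ℝ 1 V (0, η₀))
    (hVd : HasFDerivAt (fun η => V (0, η)) ((twist c).comp ((ContinuousLinearMap.mul ℝ ℂ) e)) η₀)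
    (hzero : twist c (η₀ ^ k * g z) + V (0, η₀) = 0)
    (hne : k * η₀ ^ (k - 1) * g z + e ≠ 0) {U : Set (ℝ × ℂ)} (hU : U ∈ 𝓝 ((0 : ℝ), η₀)) :
    ∀ᶠ ε in 𝓝 (0 : ℝ), ∃ η, (ε, η) ∈ U ∧ blowup c z g r k (ε, η) + V (ε, η) = 0 := by
  set Φ : ℝ × ℂ → ℂ := fun x => blowup c z g r k x + V x with hΦ
  have hΦc : ContDiffAt ℝ 1 Φ (0, η₀) := (contDiffAt_blowup hg hr k η₀).add hV
  have hΦs := hΦc.hasStrictFDerivAt one_ne_zero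
  have hpart : HasFDerivAt (fun η => Φ (0, η))
      ((twist c).comp ((ContinuousLinearMap.mul ℝ ℂ) (k * η₀ ^ (k - 1) * g z + e))) η₀ := by
    have hb : HasFDerivAt (fun η : ℂ => blowup c z g r k (0, η))
        ((twist c).comp ((ContinuousLinearMap.mul ℝ ℂ) (k * η₀ ^ (k - 1) * g z))) η₀ := by
      have h0 : (fun η : ℂ => blowup c z g r k (0, η)) =
          (twist c) ∘ (fun η : ℂ => η ^ k * g z) := by
        funext η; simp [blowup]
      rw [h0]
      refine (twist c).hasFDerivAt.comp η₀ ?_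
      have := ((hasDerivAt_pow k η₀).mul_const (g z)).hasFDerivAt.restrictScalars ℝ
      refine this.congr_fderiv ?_
      ext y
      simp [mul_comm]
    refine (hb.add hVd).congr_fderiv ?_
    ext y
    simp
  have hinl : HasFDerivAt (fun η : ℂ => ((0 : ℝ), η)) (ContinuousLinearMap.inr ℝ ℝ ℂ) η₀ :=
    (ContinuousLinearMap.inr ℝ ℝ ℂ).hasFDerivAt
  have hcomp : HasFDerivAt (fun η => Φ (0, η))
      ((fderiv ℝ Φ (0, η₀)).comp (ContinuousLinearMap.inr ℝ ℝ ℂ)) η₀ :=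
    hΦs.hasFDerivAt.comp η₀ hinl
  have heq := hcomp.unique hpart
  have hΨs : HasStrictFDerivAt (fun x : ℝ × ℂ => (x.1, Φ x))
      ((ContinuousLinearMap.fst ℝ ℝ ℂ).prod (fderiv ℝ Φ (0, η₀))) (0, η₀) :=
    (ContinuousLinearMap.fst ℝ ℝ ℂ).hasStrictFDerivAt.prodMk hΦs
  have hsurj : ((ContinuousLinearMap.fst ℝ ℝ ℂ).prod (fderiv ℝ Φ (0, η₀))).range = ⊤ := by
    rw [LinearMap.range_eq_top]
    rintro ⟨ε, y⟩
    obtain ⟨v, hv⟩ := twist_surjective hc (y - fderiv ℝ Φ (0, η₀) (ε, 0))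
    refine ⟨(ε, (k * η₀ ^ (k - 1) * g z + e)⁻¹ * v), ?_⟩
    have h1 := DFunLike.congr_fun heq ((k * η₀ ^ (k - 1) * g z + e)⁻¹ * v)
    simp only [ContinuousLinearMap.comp_apply, ContinuousLinearMap.inr_apply,
      ContinuousLinearMap.mul_apply', mul_inv_cancel_left₀ hne, hv] at h1
    have hsplit : ((ε, (k * η₀ ^ (k - 1) * g z + e)⁻¹ * v) : ℝ × ℂ) =
        (ε, 0) + (0, (k * η₀ ^ (k - 1) * g z + e)⁻¹ * v) := by simp
    change (ε, fderiv ℝ Φ (0, η₀) (ε, (k * η₀ ^ (k - 1) * g z + e)⁻¹ * v)) = (ε, y)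
    rw [hsplit, map_add, h1]
    simp
  have hmap := hΨs.map_nhds_eq_of_surj hsurj
  have hΦ0 : Φ (0, η₀) = 0 := by
    simp only [hΦ]
    rw [← hzero]; simp [blowup]
  have himg : (fun x : ℝ × ℂ => (x.1, Φ x)) '' U ∈ 𝓝 ((0 : ℝ), (0 : ℂ)) := by
    have := image_mem_map (m := fun x : ℝ × ℂ => (x.1, Φ x)) hU
    rw [hmap] at this
    simpa [hΦ0] using this
  have hcont : Tendsto (fun ε : ℝ => (ε, (0 : ℂ))) (𝓝 0) (𝓝 (0, 0)) :=
    (Continuous.prodMk_left (0 : ℂ)).tendsto 0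
  filter_upwards [hcont himg] with ε hε
  obtain ⟨⟨ε', η⟩, hmem, hx⟩ := hε
  simp only [Prod.mk.injEq] at hx
  obtain ⟨rfl, h2⟩ := hx
  exact ⟨η, hmem, h2⟩

/-- Near `z`, the harmonic function `G + conj K` has holomorphic parts `G`, `K` and second
dilatation `-Q²`. -/
structure DilatationAt (Q G K : ℂ → ℂ) (z : ℂ) : Prop where
  analyticAt_left : AnalyticAt ℂ G z
  analyticAt_right : AnalyticAt ℂ K z
  deriv_right : ∀ᶠ ζ in 𝓝 z, deriv K ζ = -(Q ζ) ^ 2 * deriv G ζ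

lemma DilatationAt.exists_factorization {Q G K : ℂ → ℂ} {z : ℂ} (h : DilatationAt Q G K z)
    (hQ : AnalyticAt ℂ Q z) {k : ℕ} (hk : analyticOrderAt (fun ζ => G ζ - G z) z = (k + 1 : ℕ)) :
    ∃ g r : ℂ → ℂ, AnalyticAt ℂ g z ∧ AnalyticAt ℂ r z ∧ g z ≠ 0 ∧
      ∀ᶠ ζ in 𝓝 z, G ζ - G z = (ζ - z) ^ (k + 1) * g ζ ∧
        G ζ + conj (K ζ) - (G z + conj (K z)) = twist (Q z) ((ζ - z) ^ (k + 1) * g ζ) +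
          conj ((ζ - z) ^ (k + 2) * r ζ) := by
  obtain ⟨hG, hK, hd⟩ := h
  obtain ⟨g, r, hg, hr, hgz, he⟩ := exists_twist_factorization (G := fun ζ => G ζ - G z)
    (K := fun ζ => K ζ - K z) (by fun_prop) (by fun_prop) hQ (by simp) (by simp)
    (by simpa using hd) hk
  refine ⟨g, r, hg, hr, hgz, ?_⟩
  filter_upwards [he] with ζ hζ
  refine ⟨hζ.1, ?_⟩
  rw [← hζ.2, map_sub]
  ring

/-- A zero of `G + conj K` persists, and moves off `z`, when the function is perturbed by a small
positive multiple of another harmonic function `g + conj k` with the same dilatation. -/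
lemma DilatationAt.exists_perturbed_zero {Q G K g k : ℂ → ℂ} {z : ℂ} (h : DilatationAt Q G K z)
    (h' : DilatationAt Q g k z) (hQ : AnalyticAt ℂ Q z) (hc : ‖Q z‖ < 1)
    (hH : G z + conj (K z) = 0) (hnc : ¬ ∀ᶠ ζ in 𝓝 z, G ζ = G z)
    (hcase : g z + conj (k z) ≠ 0 ∨ g z + conj (k z) = 0 ∧ deriv g z ≠ 0 ∧ deriv G z = 0)
    {U : Set ℂ} (hU : U ∈ 𝓝 z) {δ₀ : ℝ} (hδ₀ : 0 < δ₀) :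
    ∃ ζ ∈ U, ζ ≠ z ∧ ∃ δ : ℝ, 0 < δ ∧ δ < δ₀ ∧
      G ζ + conj (K ζ) = -δ * (g ζ + conj (k ζ)) := by
  have hGan : AnalyticAt ℂ (fun ζ => G ζ - G z) z := by
    have := h.analyticAt_left
    fun_prop
  have hfin : analyticOrderAt (fun ζ => G ζ - G z) z ≠ ⊤ := by
    rw [Ne, analyticOrderAt_eq_top]
    simpa [sub_eq_zero] using hnc
  obtain ⟨m, hm⟩ := ENat.ne_top_iff_exists.mp hfin
  have hm0 : m ≠ 0 := by
    have : analyticOrderAt (fun ζ => G ζ - G z) z ≠ 0 := by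
      rw [hGan.analyticOrderAt_ne_zero]; simp
    rw [← hm] at this
    exact_mod_cast this
  obtain ⟨n, rfl⟩ := Nat.exists_eq_succ_of_ne_zero hm0
  obtain ⟨a, r, ha, hr, haz, hfac⟩ := h.exists_factorization hQ hm.symm
  rw [hH] at hfac
  have hlim : ∀ η₀ : ℂ, Tendsto (fun x : ℝ × ℂ => z + x.1 * x.2) (𝓝 ((0 : ℝ), η₀)) (𝓝 z) := by
    intro η₀
    have : Continuous (fun x : ℝ × ℂ => z + x.1 * x.2) := by fun_prop
    simpa using this.tendsto ((0 : ℝ), η₀)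
  rcases hcase with hw | ⟨hw, hg', hG'⟩
  · -- the perturbation does not vanish at `z`
    set w : ℂ → ℂ := fun ζ => g ζ + conj (k ζ) with hwdef
    obtain ⟨y, hy⟩ := twist_surjective hc (-w z)
    obtain ⟨η₀, hη₀⟩ := IsAlgClosed.exists_pow_nat_eq (y / a z) (Nat.succ_pos n)
    have hy0 : y ≠ 0 := by
      rintro rfl
      exact hw (by simpa using hy.symm)
    have hη0 : η₀ ≠ 0 := by
      rintro rfl
      rw [zero_pow (Nat.succ_ne_zero n)] at hη₀
      exact div_ne_zero hy0 haz hη₀.symm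
    have hwc : ContDiffAt ℝ 1 w z :=
      (h'.analyticAt_left.contDiffAt.restrict_scalars ℝ).add
        ((Complex.conjCLE : ℂ →L[ℝ] ℂ).contDiff.contDiffAt.comp z
          (h'.analyticAt_right.contDiffAt.restrict_scalars ℝ))
    have hV : ContDiffAt ℝ 1 (fun x : ℝ × ℂ => w (z + x.1 * x.2)) (0, η₀) := by
      refine ContDiffAt.comp (g := w) (0, η₀) (by simpa using hwc) ?_
      have h1 : ContDiff ℝ 1 (fun x : ℝ × ℂ => (x.1 : ℂ)) :=
        Complex.ofRealCLM.contDiff.comp contDiff_fst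
      exact (contDiff_const.add (h1.mul contDiff_snd)).contDiffAt
    have key := eventually_exists_blowup_add_eq_zero hc ha hr (k := n + 1) (η₀ := η₀) (e := 0) hV
      (by simpa using hasFDerivAt_const (w z) η₀)
      (by rw [hη₀, div_mul_cancel₀ _ haz, hy]; simp)
      (by
        rw [add_zero]
        refine mul_ne_zero (mul_ne_zero ?_ (pow_ne_zero _ hη0)) haz
        exact_mod_cast Nat.succ_ne_zero n)
      (inter_mem (hlim η₀ hU) (hlim η₀ hfac))
    have hsmall : ∀ᶠ ε in 𝓝[>] (0 : ℝ), ε ^ (n + 1) < δ₀ := by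
      have : Tendsto (fun ε : ℝ => ε ^ (n + 1)) (𝓝 0) (𝓝 0) := by
        simpa using (continuous_pow (M := ℝ) (n + 1)).tendsto 0
      exact (this.eventually_lt_const hδ₀).filter_mono nhdsWithin_le_nhds
    obtain ⟨ε, ⟨η, ⟨hmU, hmf⟩, hz⟩, hεδ, hε⟩ := ((key.filter_mono nhdsWithin_le_nhds).and
      (hsmall.and self_mem_nhdsWithin)).exists
    have hε : 0 < ε := hε
    have hval : G (z + ε * η) + conj (K (z + ε * η)) = -(ε ^ (n + 1) : ℝ) * w (z + ε * η) := by
      have h2 := hmf.2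
      simp only [sub_zero] at h2
      rw [h2, ← pow_mul_blowup, eq_neg_of_add_eq_zero_left hz]
      push_cast; ring
    refine ⟨z + ε * η, hmU, ?_, ε ^ (n + 1), by positivity, hεδ, hval⟩
    intro hzz
    rw [hzz, hH] at hval
    have : (ε ^ (n + 1) : ℝ) ≠ 0 := by positivity
    exact mul_ne_zero (neg_ne_zero.mpr (by exact_mod_cast this)) hw hval.symm
  · -- the perturbation has a simple zero at `z`, and `G - G z` a multiple one
    have hg1 : analyticOrderAt (fun ζ => g ζ - g z) z = (0 + 1 : ℕ) := by
      have hgan : AnalyticAt ℂ (fun ζ => g ζ - g z) z := by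
        have := h'.analyticAt_left
        fun_prop
      have := (analyticOrderAt_deriv_eq_iff hgan (by simp) (n := 0)).mpr (by
        have : deriv (fun ζ => g ζ - g z) = deriv g := by funext x; simp
        rw [this]
        simpa using (h'.analyticAt_left.deriv.analyticOrderAt_eq_zero).mpr hg')
      simpa using this
    obtain ⟨b, s, hb, hs, hbz, hfac'⟩ := h'.exists_factorization hQ hg1
    rw [hw] at hfac'
    obtain ⟨n, rfl⟩ : ∃ j, n = j + 1 := by
      refine Nat.exists_eq_succ_of_ne_zero ?_
      rintro rfl
      have := (analyticOrderAt_deriv_eq_iff hGan (by simp) (n := 0)).mp (by simpa using hm.symm)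
      have hde : deriv (fun ζ => G ζ - G z) = deriv G := by funext x; simp
      rw [hde] at this
      exact (h.analyticAt_left.deriv.analyticOrderAt_eq_zero).mp (by simpa using this) hG'
    obtain ⟨η₀, hη₀⟩ := IsAlgClosed.exists_pow_nat_eq (-b z / a z) (Nat.succ_pos n)
    have hη0 : η₀ ≠ 0 := by
      rintro rfl
      rw [zero_pow (Nat.succ_ne_zero n)] at hη₀
      exact div_ne_zero (neg_ne_zero.mpr hbz) haz hη₀.symm
    have hη₀' : η₀ ^ (n + 1) * a z = -b z := by
      rw [hη₀, div_mul_cancel₀ _ haz]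
    have hVd : HasFDerivAt (fun η : ℂ => blowup (Q z) z b s 1 (0, η))
        ((twist (Q z)).comp ((ContinuousLinearMap.mul ℝ ℂ) (b z))) η₀ := by
      have h0 : (fun η : ℂ => blowup (Q z) z b s 1 (0, η)) =
          (twist (Q z)).comp ((ContinuousLinearMap.mul ℝ ℂ) (b z)) := by
        funext η; simp [blowup, mul_comm]
      rw [h0]
      exact ContinuousLinearMap.hasFDerivAt _
    have hev : ∀ᶠ x : ℝ × ℂ in 𝓝 (0, η₀), x.2 ≠ 0 :=
      (continuous_snd.tendsto ((0 : ℝ), η₀)).eventually_ne hη0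
    have key := eventually_exists_blowup_add_eq_zero hc ha hr (k := n + 1 + 1) (η₀ := η₀)
      (e := b z) (contDiffAt_blowup (c := Q z) hb hs 1 η₀) hVd
      (by
        rw [pow_succ, mul_right_comm, hη₀']
        simp [blowup, mul_comm])
      (by
        rw [Nat.add_sub_cancel, mul_assoc, hη₀']
        have : ((n + 1 + 1 : ℕ) : ℂ) * -b z + b z = -((n + 1 : ℕ) : ℂ) * b z := by
          push_cast; ring
        rw [this]
        refine mul_ne_zero (neg_ne_zero.mpr ?_) hbz
        exact_mod_cast Nat.succ_ne_zero n)
      (inter_mem hev (inter_mem (hlim η₀ hU) (inter_mem (hlim η₀ hfac) (hlim η₀ hfac'))))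
    have hsmall : ∀ᶠ ε in 𝓝[>] (0 : ℝ), ε ^ (n + 1) < δ₀ := by
      have : Tendsto (fun ε : ℝ => ε ^ (n + 1)) (𝓝 0) (𝓝 0) := by
        simpa using (continuous_pow (M := ℝ) (n + 1)).tendsto 0
      exact (this.eventually_lt_const hδ₀).filter_mono nhdsWithin_le_nhds
    obtain ⟨ε, ⟨η, ⟨hη, hmU, hmf, hmf'⟩, hz⟩, hεδ, hε⟩ :=
      ((key.filter_mono nhdsWithin_le_nhds).and (hsmall.and self_mem_nhdsWithin)).exists
    have hε : 0 < ε := hε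
    have hη : η ≠ 0 := hη
    refine ⟨z + ε * η, hmU, ?_, ε ^ (n + 1), by positivity, hεδ, ?_⟩
    · have : (ε : ℂ) * η ≠ 0 := mul_ne_zero (by exact_mod_cast hε.ne') hη
      simpa using this
    · have h2 := hmf.2
      have h3 := hmf'.2
      simp only [sub_zero] at h2 h3
      rw [h2, h3, ← pow_mul_blowup]
      have h4 := pow_mul_blowup (Q z) z b s 1 ε η
      rw [zero_add, zero_add, ← h4, eq_neg_of_add_eq_zero_left hz]
      push_cast; ring

/-- On `Ω`, the harmonic function `G + conj K` has holomorphic parts `G`, `K` and second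
dilatation `-Q²`. -/
structure DilatationOn (Q G K : ℂ → ℂ) (Ω : Set ℂ) : Prop where
  differentiableOn_left : DifferentiableOn ℂ G Ω
  differentiableOn_right : DifferentiableOn ℂ K Ω
  deriv_right : ∀ ζ ∈ Ω, deriv K ζ = -(Q ζ) ^ 2 * deriv G ζ

namespace DilatationOn

variable {Q G K g k : ℂ → ℂ} {Ω : Set ℂ}

lemma dilatationAt (h : DilatationOn Q G K Ω) (hΩ : IsOpen Ω) {z : ℂ} (hz : z ∈ Ω) :
    DilatationAt Q G K z where
  analyticAt_left := h.differentiableOn_left.analyticAt (hΩ.mem_nhds hz)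
  analyticAt_right := h.differentiableOn_right.analyticAt (hΩ.mem_nhds hz)
  deriv_right := by
    filter_upwards [hΩ.mem_nhds hz] with ζ hζ using h.deriv_right ζ hζ

lemma deriv_sub_mul (hΩ : IsOpen Ω) {z : ℂ} (hz : z ∈ Ω) (hG : DifferentiableOn ℂ G Ω)
    (hg : DifferentiableOn ℂ g Ω) (l : ℂ) :
    deriv (fun ζ => G ζ - l * g ζ) z = deriv G z - l * deriv g z := by
  have h1 := hG.differentiableAt (hΩ.mem_nhds hz)
  have h2 := hg.differentiableAt (hΩ.mem_nhds hz)
  rw [deriv_fun_sub h1 (h2.const_mul l), deriv_const_mul _ h2]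

lemma sub_mul (h : DilatationOn Q G K Ω) (h' : DilatationOn Q g k Ω) (hΩ : IsOpen Ω) (l : ℂ) :
    DilatationOn Q (fun ζ => G ζ - l * g ζ) (fun ζ => K ζ - l * k ζ) Ω where
  differentiableOn_left := h.differentiableOn_left.sub (h'.differentiableOn_left.const_mul l)
  differentiableOn_right := h.differentiableOn_right.sub (h'.differentiableOn_right.const_mul l)
  deriv_right ζ hζ := by
    rw [deriv_sub_mul hΩ hζ h.differentiableOn_right h'.differentiableOn_right,
      deriv_sub_mul hΩ hζ h.differentiableOn_left h'.differentiableOn_left,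
      h.deriv_right ζ hζ, h'.deriv_right ζ hζ]
    ring

lemma add_conj_eq_zero (h : DilatationOn Q G K Ω) (hΩ : IsOpen Ω) (hΩc : IsPreconnected Ω)
    {z : ℂ} (hz : z ∈ Ω) (h0 : G z + conj (K z) = 0) (hG : ∀ᶠ ζ in 𝓝 z, G ζ = G z) :
    ∀ ζ ∈ Ω, G ζ + conj (K ζ) = 0 := by
  have hGc : EqOn G (fun _ => G z) Ω :=
    (h.differentiableOn_left.analyticOnNhd hΩ).eqOn_of_preconnected_of_eventuallyEq
      analyticOnNhd_const hΩc hz hG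
  have hG' : ∀ ζ ∈ Ω, deriv G ζ = 0 := fun ζ hζ => by
    have : G =ᶠ[𝓝 ζ] fun _ => G z := by
      filter_upwards [hΩ.mem_nhds hζ] with x hx using hGc hx
    rw [this.deriv_eq, deriv_const]
  have hKc : ∀ ζ ∈ Ω, K ζ = K z := fun ζ hζ =>
    hΩ.is_const_of_deriv_eq_zero hΩc h.differentiableOn_right
      (fun x hx => by rw [h.deriv_right x hx, hG' x hx, mul_zero]; rfl) hζ hz
  intro ζ hζ
  rw [hGc hζ, hKc ζ hζ, h0]

/-- If `G + conj K = l (g + conj k)` at `z` but not identically, then the equation has solutions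
other than `z`, arbitrarily close to `z`, for some smaller parameter `l'`. -/
lemma exists_lt_zero (h : DilatationOn Q G K Ω) (h' : DilatationOn Q g k Ω) (hΩ : IsOpen Ω)
    (hΩc : IsPreconnected Ω) (hQ : DifferentiableOn ℂ Q Ω) (hQ1 : ∀ ζ ∈ Ω, ‖Q ζ‖ < 1)
    {z : ℂ} (hz : z ∈ Ω) {l : ℝ} (hl : 0 < l)
    (hzero : G z + conj (K z) = l * (g z + conj (k z)))
    (hcase : G z + conj (K z) ≠ 0 ∨
      G z + conj (K z) = 0 ∧ deriv G z ≠ 0 ∧ deriv G z = l * deriv g z)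
    (hne : ¬ ∀ ζ ∈ Ω, G ζ + conj (K ζ) = l * (g ζ + conj (k ζ))) {U : Set ℂ} (hU : U ∈ 𝓝 z) :
    ∃ ζ ∈ U, ζ ≠ z ∧ ∃ l' : ℝ, 0 < l' ∧ l' < l ∧
      G ζ + conj (K ζ) = l' * (g ζ + conj (k ζ)) := by
  have hd := h.sub_mul h' hΩ (l : ℂ)
  have key : ∀ ζ, G ζ - l * g ζ + conj (K ζ - l * k ζ) =
      G ζ + conj (K ζ) - l * (g ζ + conj (k ζ)) := fun ζ => by
    simp only [map_sub, map_mul, Complex.conj_ofReal]; ring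
  obtain ⟨ζ, hζU, hζz, δ, hδ, -, he⟩ := (hd.dilatationAt hΩ hz).exists_perturbed_zero
    (h.dilatationAt hΩ hz) (hQ.analyticAt (hΩ.mem_nhds hz)) (hQ1 z hz)
    (by rw [key, hzero, sub_self])
    (fun hc => hne fun ζ hζ => by
      have := hd.add_conj_eq_zero hΩ hΩc hz (by rw [key, hzero, sub_self]) hc ζ hζ
      rw [key] at this
      exact sub_eq_zero.mp this)
    (hcase.imp id fun hc => ⟨hc.1, hc.2.1, by
      rw [deriv_sub_mul hΩ hz h.differentiableOn_left h'.differentiableOn_left, ← hc.2.2,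
        sub_self]⟩) hU one_pos
  refine ⟨ζ, hζU, hζz, l / (1 + δ), by positivity, div_lt_self hl (by linarith), ?_⟩
  rw [key] at he
  have : (1 + δ : ℂ) ≠ 0 := by exact_mod_cast (by positivity : 1 + δ ≠ 0)
  push_cast
  field_simp
  linear_combination he

/-- A harmonic diffeomorphism `G + conj K` of `Ω` onto the unit disk, compared with a harmonic map
`g + conj k` of `Ω` into the closed unit disk that has the same dilatation, vanishes at the same
point and has proportional derivative there, with ratio at most one. -/
theorem eq_mul_of_le_one (h : DilatationOn Q G K Ω) (h' : DilatationOn Q g k Ω) (hΩ : IsOpen Ω)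
    (hΩc : IsPreconnected Ω) (hQ : DifferentiableOn ℂ Q Ω) (hQ1 : ∀ ζ ∈ Ω, ‖Q ζ‖ < 1)
    {Z : ℂ → ℂ} (hZ : ContinuousOn Z (Metric.ball 0 1)) (hZΩ : ∀ x ∈ Metric.ball (0 : ℂ) 1, Z x ∈ Ω)
    (hwZ : ∀ x ∈ Metric.ball (0 : ℂ) 1, G (Z x) + conj (K (Z x)) = x)
    (hZw : ∀ ζ ∈ Ω, Z (G ζ + conj (K ζ)) = ζ)
    (hw : ∀ ζ ∈ Ω, G ζ + conj (K ζ) ∈ Metric.ball (0 : ℂ) 1)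
    (hZ0 : DifferentiableAt ℝ Z 0) (hT0 : g (Z 0) + conj (k (Z 0)) = 0)
    (hT : ∀ ζ ∈ Ω, ‖g ζ + conj (k ζ)‖ ≤ 1) {l : ℝ} (hl : 0 < l) (hl1 : l ≤ 1)
    (hG0 : deriv G (Z 0) ≠ 0) (hl0 : deriv G (Z 0) = l * deriv g (Z 0)) :
    ∀ ζ ∈ Ω, G ζ + conj (K ζ) = l * (g ζ + conj (k ζ)) := by
  by_contra hne
  have h0 : (0 : ℂ) ∈ Metric.ball (0 : ℂ) 1 := by simp
  have hz0 : Z 0 ∈ Ω := hZΩ 0 h0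
  obtain ⟨ζ₁, hζ₁, hζ₁0, l₁, hl₁, hl₁l, he₁⟩ := h.exists_lt_zero h' hΩ hΩc hQ hQ1 hz0 hl
    (by rw [hwZ 0 h0, hT0, mul_zero]) (Or.inr ⟨hwZ 0 h0, hG0, hl0⟩) hne (hΩ.mem_nhds hz0)
  -- zeros are isolated from the origin, uniformly for `t ≤ l₁`
  have hiso : ∃ ρ > 0, ∀ x ∈ Metric.ball (0 : ℂ) 1, ∀ t : ℝ, 0 ≤ t → t ≤ l₁ →
      x = t * (g (Z x) + conj (k (Z x))) → ‖x‖ < ρ → x = 0 := by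
    have hd := h.sub_mul h' hΩ (l : ℂ)
    have hdG : HasDerivAt (fun ζ => G ζ - l * g ζ) 0 (Z 0) := by
      have := (hd.differentiableOn_left.differentiableAt (hΩ.mem_nhds hz0)).hasDerivAt
      rwa [deriv_sub_mul hΩ hz0 h.differentiableOn_left h'.differentiableOn_left, ← hl0,
        sub_self] at this
    have hdK : HasDerivAt (fun ζ => K ζ - l * k ζ) 0 (Z 0) := by
      have := (hd.differentiableOn_right.differentiableAt (hΩ.mem_nhds hz0)).hasDerivAt
      rwa [hd.deriv_right _ hz0, hdG.deriv, mul_zero] at this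
    have hH : HasFDerivAt (fun ζ => G ζ - l * g ζ + conj (K ζ - l * k ζ)) (0 : ℂ →L[ℝ] ℂ) (Z 0) := by
      have h1 := hdG.hasFDerivAt.restrictScalars ℝ
      have h2 := hdK.hasFDerivAt.restrictScalars ℝ
      have h3 := h1.add ((Complex.conjCLE.toContinuousLinearMap.hasFDerivAt).comp (Z 0) h2)
      refine (h3.congr_fderiv ?_)
      ext; simp
    have hHZ := hH.comp 0 hZ0.hasFDerivAt
    rw [ContinuousLinearMap.zero_comp] at hHZ
    have ho := hHZ.isLittleO
    have hc : 0 < (l - l₁) / 2 := by linarith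
    obtain ⟨ρ, hρ, hb⟩ := Metric.eventually_nhds_iff.mp (ho.def hc)
    refine ⟨ρ, hρ, fun x hx t ht htl hxt hxρ => ?_⟩
    have hb' := hb (y := x) (by simpa using hxρ)
    have e1 : ∀ y ∈ Metric.ball (0 : ℂ) 1, G (Z y) - l * g (Z y) + conj (K (Z y) - l * k (Z y)) =
        y - l * (g (Z y) + conj (k (Z y))) := fun y hy => by
      simp only [map_sub, map_mul, Complex.conj_ofReal]
      linear_combination hwZ y hy
    simp only [Function.comp_apply, sub_zero, zero_apply] at hb'
    rw [e1 x hx, e1 0 h0, hT0, mul_zero, sub_zero, sub_zero] at hb'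
    have e2 : (t : ℂ) * (x - l * (g (Z x) + conj (k (Z x)))) = ((t - l : ℝ) : ℂ) * x := by
      push_cast
      linear_combination (-(l : ℂ)) * hxt.symm
    have e3 := congrArg norm e2
    rw [norm_mul, norm_mul, Complex.norm_real, Complex.norm_real, Real.norm_eq_abs,
      Real.norm_eq_abs, abs_of_nonneg ht, abs_of_neg (by linarith : t - l < 0)] at e3
    by_contra hx0
    have hx0' : 0 < ‖x‖ := norm_pos_iff.mpr hx0
    have e4 : t * ‖x - l * (g (Z x) + conj (k (Z x)))‖ ≤ 1 * ((l - l₁) / 2 * ‖x‖) :=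
      mul_le_mul (by linarith) hb' (norm_nonneg _) zero_le_one
    nlinarith
  obtain ⟨ρ, hρ, hiso⟩ := hiso
  have hl₁1 : l₁ < 1 := by linarith
  -- the compact set of nonzero solutions
  let C : Set (ℂ × ℝ) := (Metric.closedBall 0 l₁ ∩ {x | ρ ≤ ‖x‖}) ×ˢ Icc 0 l₁
  have hC : IsCompact C :=
    ((isCompact_closedBall _ _).inter_right (isClosed_le continuous_const continuous_norm)).prod
      isCompact_Icc
  have hCb : ∀ p ∈ C, p.1 ∈ Metric.ball (0 : ℂ) 1 := fun p hp =>
    Metric.closedBall_subset_ball hl₁1 hp.1.1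
  have hTZ : ContinuousOn (fun x => g (Z x) + conj (k (Z x))) (Metric.ball 0 1) :=
    (h'.differentiableOn_left.continuousOn.comp hZ hZΩ).add
      (Complex.continuous_conj.comp_continuousOn
        (h'.differentiableOn_right.continuousOn.comp hZ hZΩ))
  let φ : ℂ × ℝ → ℂ := fun p => p.1 - p.2 * (g (Z p.1) + conj (k (Z p.1)))
  have hφ : ContinuousOn φ C := by
    refine continuousOn_fst.sub (ContinuousOn.mul ?_ (hTZ.comp continuousOn_fst hCb))
    exact (Complex.continuous_ofReal.comp continuous_snd).continuousOn
  have hS : IsCompact (C ∩ φ ⁻¹' {0}) :=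
    hC.of_isClosed_subset (hφ.preimage_isClosed_of_isClosed hC.isClosed isClosed_singleton)
      inter_subset_left
  have hmem : ∀ ζ ∈ Ω, ∀ t : ℝ, 0 < t → t ≤ l₁ → G ζ + conj (K ζ) = t * (g ζ + conj (k ζ)) →
      G ζ + conj (K ζ) ≠ 0 → (G ζ + conj (K ζ), t) ∈ C ∩ φ ⁻¹' {0} := by
    intro ζ hζ t ht htl he hn
    have hnorm : ‖G ζ + conj (K ζ)‖ ≤ l₁ := by
      rw [he, norm_mul, Complex.norm_real, Real.norm_eq_abs, abs_of_pos ht]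
      nlinarith [hT ζ hζ, norm_nonneg (g ζ + conj (k ζ))]
    refine ⟨⟨⟨by simpa using hnorm, ?_⟩, ht.le, htl⟩, ?_⟩
    · by_contra hlt
      exact hn (hiso _ (hw ζ hζ) t ht.le htl (by rw [hZw ζ hζ]; exact he) (not_le.mp hlt))
    · simp only [φ, mem_preimage, mem_singleton_iff]
      rw [hZw ζ hζ, he, sub_self]
  have hSne : (C ∩ φ ⁻¹' {0}).Nonempty :=
    ⟨_, hmem ζ₁ hζ₁ l₁ hl₁ le_rfl he₁ fun hn => hζ₁0 (by rw [← hZw ζ₁ hζ₁, hn])⟩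
  obtain ⟨⟨x, t⟩, ⟨⟨⟨hx1, hx2⟩, ht0, ht1⟩, hxt⟩, hmin⟩ :=
    hS.exists_isMinOn hSne continuousOn_snd
  have hxb : x ∈ Metric.ball (0 : ℂ) 1 := Metric.closedBall_subset_ball hl₁1 hx1
  have hxt : x = t * (g (Z x) + conj (k (Z x))) := sub_eq_zero.mp hxt
  have hx0 : x ≠ 0 := norm_pos_iff.mp (hρ.trans_le hx2)
  have ht : 0 < t := lt_of_le_of_ne ht0 fun hh => hx0 (by rw [hxt, ← hh]; simp)
  have hzx := hZΩ x hxb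
  have hnon : ¬ ∀ ζ ∈ Ω, G ζ + conj (K ζ) = t * (g ζ + conj (k ζ)) := by
    intro hall
    have hyb : (((1 + t) / 2 : ℝ) : ℂ) ∈ Metric.ball (0 : ℂ) 1 := by
      rw [mem_ball_zero_iff, Complex.norm_real, Real.norm_eq_abs, abs_of_pos (by linarith)]
      linarith
    have := congrArg norm (hall _ (hZΩ _ hyb))
    rw [hwZ _ hyb, Complex.norm_real, norm_mul, Complex.norm_real, Real.norm_eq_abs,
      Real.norm_eq_abs, abs_of_pos (by linarith), abs_of_pos ht] at this
    nlinarith [hT _ (hZΩ _ hyb)]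
  have hwc : ContinuousAt (fun ζ => G ζ + conj (K ζ)) (Z x) :=
    (h.differentiableOn_left.continuousOn.continuousAt (hΩ.mem_nhds hzx)).add
      (Complex.continuous_conj.continuousAt.comp
        (h.differentiableOn_right.continuousOn.continuousAt (hΩ.mem_nhds hzx)))
  obtain ⟨ζ, ⟨hζ, hζ0⟩, -, t', ht', htt', he'⟩ := h.exists_lt_zero h' hΩ hΩc hQ hQ1 hzx ht
    (by rw [hwZ x hxb]; exact hxt) (Or.inl (by rwa [hwZ x hxb])) hnon
    (inter_mem (hΩ.mem_nhds hzx) (hwc.eventually_ne (by rwa [hwZ x hxb])))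
  have := hmin (hmem ζ hζ t' ht' (htt'.le.trans ht1) he' hζ0)
  simp only [mem_ofPred_eq] at this
  linarith

end DilatationOn

/-- The logarithm whose imaginary part is the argument of `1 - q e^{-it}`. -/
noncomputable def logKernel (t : ℝ) (q : ℂ) : ℂ := Complex.log (1 - q * Complex.exp (-t * Complex.I))

lemma norm_mul_exp_neg (t : ℝ) (q : ℂ) : ‖q * Complex.exp (-t * Complex.I)‖ = ‖q‖ := by
  have : (-t * Complex.I : ℂ) = ((-t : ℝ) : ℂ) * Complex.I := by push_cast; ring
  rw [norm_mul, this, Complex.norm_exp_ofReal_mul_I, mul_one]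

lemma re_one_sub_mul_exp_pos (t : ℝ) {q : ℂ} (hq : ‖q‖ < 1) :
    0 < (1 - q * Complex.exp (-t * Complex.I)).re := by
  have h := Complex.re_le_norm (q * Complex.exp (-t * Complex.I))
  rw [norm_mul_exp_neg] at h
  rw [Complex.sub_re, Complex.one_re]
  linarith

lemma one_sub_mul_exp_ne_zero (t : ℝ) {q : ℂ} (hq : ‖q‖ < 1) :
    1 - q * Complex.exp (-t * Complex.I) ≠ 0 := fun h => by
  have := re_one_sub_mul_exp_pos t hq
  rw [h, Complex.zero_re] at this
  exact this.false

lemma hasDerivAt_logKernel (t : ℝ) {q : ℂ} (hq : ‖q‖ < 1) :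
    HasDerivAt (logKernel t)
      (-Complex.exp (-t * Complex.I) / (1 - q * Complex.exp (-t * Complex.I))) q := by
  have h1 : HasDerivAt (fun q : ℂ => 1 - q * Complex.exp (-t * Complex.I))
      (-Complex.exp (-t * Complex.I)) q := by
    simpa using ((hasDerivAt_id q).mul_const (Complex.exp (-t * Complex.I))).const_sub 1
  exact h1.clog (Or.inl (re_one_sub_mul_exp_pos t hq))

lemma logKernel_im_sub_lt {a b : ℝ} (hab : a < b) {q : ℂ} (hq : ‖q‖ < 1) :
    (logKernel a q).im - (logKernel b q).im < (b - a) / 2 := by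
  simp only [logKernel, Complex.log_im]
  set X := 1 - q * Complex.exp (-a * Complex.I) with hX
  set Y := 1 - q * Complex.exp (-b * Complex.I) with hY
  have hX0 : 0 < X.re := re_one_sub_mul_exp_pos a hq
  have hY0 : 0 < Y.re := re_one_sub_mul_exp_pos b hq
  have h1 := (abs_lt.mp (Complex.abs_arg_lt_pi_div_two_iff.mpr (Or.inl hX0)))
  have h2 := (abs_lt.mp (Complex.abs_arg_lt_pi_div_two_iff.mpr (Or.inl hY0)))
  have hXn : X ≠ 0 := fun h => by simp [h] at hX0
  have hYn : Y ≠ 0 := fun h => by simp [h] at hY0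
  by_contra hle
  have hs : 0 ≤ Real.sin (X.arg - Y.arg - (b - a) / 2) :=
    Real.sin_nonneg_of_nonneg_of_le_pi (by linarith) (by linarith)
  let S : ℂ := Complex.exp (((a + b) / 2 : ℝ) * Complex.I)
  let D : ℂ := Complex.exp (((b - a) / 2 : ℝ) * Complex.I)
  have hXe : X = ‖X‖ * Complex.exp (X.arg * Complex.I) := (Complex.norm_mul_exp_arg_mul_I X).symm
  have hYe : conj Y = ‖Y‖ * Complex.exp (-Y.arg * Complex.I) := by
    conv_lhs => rw [← Complex.norm_mul_exp_arg_mul_I Y]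
    rw [map_mul, Complex.conj_ofReal, ← Complex.exp_conj, map_mul, Complex.conj_ofReal,
      Complex.conj_I]
    ring_nf
  have hprod : X * conj Y * conj D = ((‖X‖ * ‖Y‖ : ℝ) : ℂ) *
      Complex.exp ((X.arg - Y.arg - (b - a) / 2 : ℝ) * Complex.I) := by
    rw [hYe]
    nth_rw 1 [hXe]
    simp only [D]
    rw [← Complex.exp_conj, map_mul, Complex.conj_ofReal, Complex.conj_I]
    have : ((X.arg - Y.arg - (b - a) / 2 : ℝ) * Complex.I : ℂ) =
      X.arg * Complex.I + -Y.arg * Complex.I + ((b - a) / 2 : ℝ) * -Complex.I := by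
      push_cast; ring
    rw [this, Complex.exp_add, Complex.exp_add]
    push_cast; ring
  have hprod' : X * conj Y * conj D = conj D - (q * conj S + conj (q * conj S)) +
      (‖q‖ ^ 2 : ℝ) * D := by
    have e1 : Complex.exp (-a * Complex.I) = conj S * D := by
      simp only [S, D]
      rw [← Complex.exp_conj, ← Complex.exp_add, map_mul, Complex.conj_ofReal, Complex.conj_I]
      congr 1; push_cast; ring
    have e2 : conj (Complex.exp (-b * Complex.I)) = S * D := by
      simp only [S, D]
      rw [← Complex.exp_conj, ← Complex.exp_add, map_mul, map_neg, Complex.conj_ofReal,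
        Complex.conj_I]
      congr 1; push_cast; ring
    have e3 : S * conj S = 1 := by
      rw [Complex.mul_conj, Complex.normSq_eq_norm_sq, Complex.norm_exp_ofReal_mul_I]; simp
    have e4 : D * conj D = 1 := by
      rw [Complex.mul_conj, Complex.normSq_eq_norm_sq, Complex.norm_exp_ofReal_mul_I]; simp
    have e5 : q * conj q = (‖q‖ ^ 2 : ℝ) := by rw [Complex.mul_conj, Complex.normSq_eq_norm_sq]
    rw [hX, hY, map_sub, map_one, map_mul, e1, e2, ← e5, map_mul, Complex.conj_conj]
    linear_combination (q * conj q * D * (conj S * S) - q * conj S - conj q * S) * e4 +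
      q * conj q * D * e3
  have him := congrArg Complex.im (hprod.symm.trans hprod')
  rw [Complex.im_ofReal_mul, Complex.exp_ofReal_mul_I_im, Complex.add_conj] at him
  simp only [D, Complex.add_im, Complex.sub_im, Complex.conj_im, Complex.exp_ofReal_mul_I_im,
    Complex.im_ofReal_mul, Complex.ofReal_im, sub_zero] at him
  have hd : 0 < Real.sin ((b - a) / 2) :=
    Real.sin_pos_of_pos_of_lt_pi (by linarith) (by linarith [Real.pi_pos])
  have hq2 : ‖q‖ ^ 2 < 1 := by nlinarith [norm_nonneg q]
  have : 0 ≤ ‖X‖ * ‖Y‖ * Real.sin (X.arg - Y.arg - (b - a) / 2) := by positivity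
  nlinarith

/-- Half the analytic completion of the harmonic measure of the arc `(a, b)` of the unit circle. -/
noncomputable def arcMeasure (a b : ℝ) (q : ℂ) : ℂ :=
  ((b - a) / 4 - (logKernel a q - logKernel b q) / (2 * Complex.I)) / π

lemma arcMeasure_re (a b : ℝ) (q : ℂ) :
    (arcMeasure a b q).re = ((b - a) / 2 - ((logKernel a q).im - (logKernel b q).im)) / π / 2 := by
  have h : (logKernel a q - logKernel b q) / (2 * Complex.I) =
      (-Complex.I) * (logKernel a q - logKernel b q) / (2 : ℝ) := by
    have := Complex.I_ne_zero
    push_cast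
    field_simp
    linear_combination (logKernel a q - logKernel b q) * Complex.I_sq
  have h2 : ((b : ℂ) - a) / 4 = (((b - a) / 4 : ℝ) : ℂ) := by push_cast; ring
  rw [arcMeasure, Complex.div_ofReal_re, Complex.sub_re, h, h2, Complex.ofReal_re,
    Complex.div_ofReal_re]
  simp
  ring

lemma arcMeasure_re_pos {a b : ℝ} (hab : a < b) {q : ℂ} (hq : ‖q‖ < 1) :
    0 < (arcMeasure a b q).re := by
  rw [arcMeasure_re]
  have := logKernel_im_sub_lt hab hq
  have : 0 < (b - a) / 2 - ((logKernel a q).im - (logKernel b q).im) := by linarith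
  positivity

lemma hasDerivAt_arcMeasure (a b : ℝ) {q : ℂ} (hq : ‖q‖ < 1) :
    HasDerivAt (arcMeasure a b)
      ((Complex.exp (-a * Complex.I) - Complex.exp (-b * Complex.I)) /
        ((1 - q * Complex.exp (-a * Complex.I)) * (1 - q * Complex.exp (-b * Complex.I))) /
          (2 * π * Complex.I)) q := by
  have h := ((((hasDerivAt_logKernel a hq).sub (hasDerivAt_logKernel b hq)).div_const
    (2 * Complex.I)).const_sub (((b : ℂ) - a) / 4)).div_const (π : ℂ)
  refine h.congr_deriv ?_
  clear h
  have h1 := one_sub_mul_exp_ne_zero a hq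
  have h2 := one_sub_mul_exp_ne_zero b hq
  have : (π : ℂ) ≠ 0 := by exact_mod_cast Real.pi_ne_zero
  generalize Complex.exp (-a * Complex.I) = x at *
  generalize Complex.exp (-b * Complex.I) = y at *
  rw [mul_comm] at h1
  have := Complex.I_ne_zero
  field_simp
  ring

/-- Holomorphic part of the harmonic map onto the quadrilateral with vertices `V₁, V₂, conj V₂,
conj V₁`, the break points being `0, τ, π, -τ`. -/
noncomputable def scherkMap (τ : ℝ) (V₁ V₂ q : ℂ) : ℂ :=
  V₁ * arcMeasure 0 τ q + V₂ * arcMeasure τ π q + conj V₂ * arcMeasure (-π) (-τ) q +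
    conj V₁ * arcMeasure (-τ) 0 q

lemma scherkMap_add_conj (τ : ℝ) (V₁ V₂ q : ℂ) :
    scherkMap τ V₁ V₂ q + conj (scherkMap τ (conj V₁) (conj V₂) q) =
      ((2 * (arcMeasure 0 τ q).re : ℝ) : ℂ) * V₁ + ((2 * (arcMeasure τ π q).re : ℝ) : ℂ) * V₂ +
      ((2 * (arcMeasure (-π) (-τ) q).re : ℝ) : ℂ) * conj V₂ +
      ((2 * (arcMeasure (-τ) 0 q).re : ℝ) : ℂ) * conj V₁ := by
  simp only [← Complex.add_conj, scherkMap, map_add, map_mul, Complex.conj_conj]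
  ring

lemma logKernel_neg_pi (q : ℂ) : logKernel (-π) q = logKernel π q := by
  have h1 : Complex.exp (-((-π : ℝ) : ℂ) * Complex.I) = -1 := by
    push_cast; rw [neg_neg, Complex.exp_pi_mul_I]
  have h2 : Complex.exp (-(π : ℂ) * Complex.I) = -1 := by
    rw [neg_mul, Complex.exp_neg, Complex.exp_pi_mul_I]; norm_num
  rw [logKernel, logKernel, h1, h2]

lemma sum_arcMeasure_re (τ : ℝ) (q : ℂ) :
    2 * (arcMeasure 0 τ q).re + 2 * (arcMeasure τ π q).re + 2 * (arcMeasure (-π) (-τ) q).re +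
      2 * (arcMeasure (-τ) 0 q).re = 1 := by
  simp only [arcMeasure_re, logKernel_neg_pi]
  have := Real.pi_ne_zero
  field_simp
  ring

lemma norm_scherkMap_le {τ : ℝ} (h0 : 0 < τ) (hπ : τ < π) {V₁ V₂ q : ℂ} (hq : ‖q‖ < 1)
    (h1 : ‖V₁‖ = 1) (h2 : ‖V₂‖ = 1) :
    ‖scherkMap τ V₁ V₂ q + conj (scherkMap τ (conj V₁) (conj V₂) q)‖ ≤ 1 := by
  have p1 := arcMeasure_re_pos h0 hq
  have p2 := arcMeasure_re_pos hπ hq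
  have p3 := arcMeasure_re_pos (a := -π) (b := -τ) (by linarith) hq
  have p4 := arcMeasure_re_pos (a := -τ) (b := 0) (by linarith) hq
  have hs := sum_arcMeasure_re τ q
  have hn : ∀ (r : ℝ) (V : ℂ), 0 < r → ‖V‖ = 1 → ‖((2 * r : ℝ) : ℂ) * V‖ = 2 * r := by
    intro r V hr hV
    rw [norm_mul, hV, Complex.norm_real, Real.norm_eq_abs, abs_of_pos (by linarith), mul_one]
  have hV₁ : ‖conj V₁‖ = 1 := by rw [RCLike.norm_conj, h1]
  have hV₂ : ‖conj V₂‖ = 1 := by rw [RCLike.norm_conj, h2]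
  rw [scherkMap_add_conj]
  refine norm_add₄_le.trans ?_
  rw [hn _ _ p1 h1, hn _ _ p2 h2, hn _ _ p3 hV₂, hn _ _ p4 hV₁, hs]

lemma re_scherkMap_le {τ : ℝ} (hπ : τ < π) {V₁ V₂ q : ℂ} (hq : ‖q‖ < 1)
    (h12 : V₂.re ≤ V₁.re) :
    (scherkMap τ V₁ V₂ q + conj (scherkMap τ (conj V₁) (conj V₂) q)).re ≤ V₁.re := by
  have p2 := arcMeasure_re_pos hπ hq
  have p3 := arcMeasure_re_pos (a := -π) (b := -τ) (by linarith) hq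
  have hs := sum_arcMeasure_re τ q
  rw [scherkMap_add_conj]
  simp only [Complex.add_re, Complex.re_ofReal_mul, Complex.conj_re]
  have e : (arcMeasure 0 τ q).re = 1 / 2 - (arcMeasure τ π q).re - (arcMeasure (-π) (-τ) q).re -
      (arcMeasure (-τ) 0 q).re := by linarith
  rw [e]
  nlinarith

lemma exists_scherk_parameter {x : ℝ} (hx0 : 0 ≤ x) (hx1 : x < 1) :
    ∃ m, 0 ≤ m ∧ 3 * m ≤ 2 * x ∧
      m = (1 - m ^ 2) * (2 / π * Real.arcsin ((x - m) / (1 - m * x))) := by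
  have hden : ∀ m ∈ Icc 0 (2 * x / 3), 0 < 1 - m * x := fun m hm => by nlinarith [hm.1, hm.2]
  let Φ : ℝ → ℝ := fun m => m - (1 - m ^ 2) * (2 / π * Real.arcsin ((x - m) / (1 - m * x)))
  have hΦ : ContinuousOn Φ (Icc 0 (2 * x / 3)) := by
    have : ContinuousOn (fun m : ℝ => (x - m) / (1 - m * x)) (Icc 0 (2 * x / 3)) :=
      ContinuousOn.div (by fun_prop) (by fun_prop) fun m hm => (hden m hm).ne'
    have := Real.continuous_arcsin.comp_continuousOn this
    have h2 : ContinuousOn (fun m : ℝ => Real.arcsin ((x - m) / (1 - m * x)))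
      (Icc 0 (2 * x / 3)) := this
    fun_prop
  have hle : (0 : ℝ) ≤ 2 * x / 3 := by linarith
  have h0 : Φ 0 ≤ 0 := by
    have : 0 ≤ 2 / π * Real.arcsin x :=
      mul_nonneg (by positivity) (Real.arcsin_nonneg.mpr hx0)
    simpa [Φ] using this
  have h1 : 0 ≤ Φ (2 * x / 3) := by
    simp only [Φ]
    set y := (x - 2 * x / 3) / (1 - 2 * x / 3 * x) with hy
    have hd : 0 < 1 - 2 * x / 3 * x := hden _ ⟨hle, le_rfl⟩
    have hy0 : 0 ≤ y := div_nonneg (by linarith) hd.le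
    have hy1 : y ≤ 1 := by rw [hy, div_le_one hd]; nlinarith
    have hj : 2 / π * Real.arcsin y ≤ y := by
      have := Real.mul_le_sin (Real.arcsin_nonneg.mpr hy0) (Real.arcsin_le_pi_div_two y)
      rwa [Real.sin_arcsin (by linarith) hy1] at this
    have hm2 : 0 ≤ 1 - (2 * x / 3) ^ 2 := by nlinarith
    have h3 : (1 - (2 * x / 3) ^ 2) * y ≤ 2 * x / 3 := by
      rw [hy, mul_div_assoc', div_le_iff₀ hd]
      nlinarith [mul_nonneg hx0 (by nlinarith : 0 ≤ 1 - 8 / 9 * x ^ 2)]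
    have := mul_le_mul_of_nonneg_left hj hm2
    linarith
  obtain ⟨m, hm, hm0⟩ := intermediate_value_Icc hle hΦ ⟨h0, h1⟩
  exact ⟨m, hm.1, by linarith [hm.2], sub_eq_zero.mp hm0⟩

lemma logKernel_im_neg (t : ℝ) {q : ℝ} (hq : ‖(q : ℂ)‖ < 1) :
    (logKernel (-t) q).im = -(logKernel t q).im := by
  have h1 : 1 - (q : ℂ) * Complex.exp (-((-t : ℝ) : ℂ) * Complex.I) =
      conj (1 - (q : ℂ) * Complex.exp (-t * Complex.I)) := by
    simp [← Complex.exp_conj]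
  have h2 := abs_lt.mp (Complex.abs_arg_lt_pi_div_two_iff.mpr
    (Or.inl (re_one_sub_mul_exp_pos t hq)))
  simp only [logKernel, Complex.log_im]
  rw [h1, Complex.arg_conj, if_neg (by linarith [Real.pi_pos])]

lemma hasDerivAt_scherkMap (τ : ℝ) (V₁ V₂ : ℂ) {q : ℂ} (hq : ‖q‖ < 1) :
    HasDerivAt (scherkMap τ V₁ V₂)
      ((V₁ * (1 - Complex.exp (-τ * Complex.I)) * (1 + q) * (1 - q * Complex.exp (τ * Complex.I)) +
        V₂ * (1 + Complex.exp (-τ * Complex.I)) * (1 - q) * (1 - q * Complex.exp (τ * Complex.I)) -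
        conj V₂ * (1 + Complex.exp (τ * Complex.I)) * (1 - q) *
          (1 - q * Complex.exp (-τ * Complex.I)) -
        conj V₁ * (1 - Complex.exp (τ * Complex.I)) * (1 + q) *
          (1 - q * Complex.exp (-τ * Complex.I))) /
        ((1 - q ^ 2) * ((1 - q * Complex.exp (-τ * Complex.I)) *
          (1 - q * Complex.exp (τ * Complex.I)))) / (2 * π * Complex.I)) q := by
  have h := ((((hasDerivAt_arcMeasure 0 τ hq).const_mul V₁).add
    ((hasDerivAt_arcMeasure τ π hq).const_mul V₂)).add
    ((hasDerivAt_arcMeasure (-π) (-τ) hq).const_mul (conj V₂))).add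
    ((hasDerivAt_arcMeasure (-τ) 0 hq).const_mul (conj V₁))
  refine h.congr_deriv ?_
  clear h
  have h0 := one_sub_mul_exp_ne_zero 0 hq
  have h1 := one_sub_mul_exp_ne_zero τ hq
  have h2 := one_sub_mul_exp_ne_zero (-τ) hq
  have h3 := one_sub_mul_exp_ne_zero (-π) hq
  have e2 : Complex.exp (-(π : ℂ) * Complex.I) = -1 := by
    rw [neg_mul, Complex.exp_neg, Complex.exp_pi_mul_I]; norm_num
  simp only [Complex.ofReal_neg, neg_neg, Complex.ofReal_zero, neg_zero, zero_mul,
    Complex.exp_zero, Complex.exp_pi_mul_I, e2, mul_one, mul_neg, sub_neg_eq_add] at *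
  have h4 : 1 - q ^ 2 ≠ 0 := by
    have : 1 - q ^ 2 = (1 - q) * (1 + q) := by ring
    rw [this]; exact mul_ne_zero h0 h3
  have : (π : ℂ) ≠ 0 := by exact_mod_cast Real.pi_ne_zero
  have := Complex.I_ne_zero
  generalize Complex.exp (-τ * Complex.I) = x at *
  generalize Complex.exp (τ * Complex.I) = y at *
  rw [← sub_eq_zero]
  have key : ∀ u v p r d : ℂ, u ≠ 0 → v ≠ 0 → p ≠ 0 → r ≠ 0 → d ≠ 0 →
      V₁ * ((1 - x) / (u * v) / d) + V₂ * ((x + 1) / (v * p) / d) +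
        conj V₂ * ((-1 - y) / (p * r) / d) + conj V₁ * ((y - 1) / (r * u) / d) -
      (V₁ * (1 - x) * p * r + V₂ * (1 + x) * u * r - conj V₂ * (1 + y) * u * v -
        conj V₁ * (1 - y) * p * v) / (u * p * (v * r)) / d = 0 := by
    intro u v p r d hu hv hp hr hd
    field_simp
    ring
  have hf : 1 - q ^ 2 = (1 - q) * (1 + q) := by ring
  rw [hf]
  exact key _ _ _ _ _ h0 h1 h3 h2 (mul_ne_zero (mul_ne_zero two_ne_zero ‹_›) ‹_›)

lemma logKernel_zero_im {q : ℝ} (hq : q ≤ 1) : (logKernel 0 q).im = 0 := by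
  have : (1 : ℂ) - q = ((1 - q : ℝ) : ℂ) := by push_cast; ring
  rw [logKernel, Complex.log_im]
  simp only [Complex.ofReal_zero, neg_zero, zero_mul, Complex.exp_zero, mul_one]
  rw [this, Complex.arg_ofReal_of_nonneg (by linarith)]

lemma logKernel_pi_im {q : ℝ} (hq : -1 ≤ q) : (logKernel π q).im = 0 := by
  have e2 : Complex.exp (-(π : ℂ) * Complex.I) = -1 := by
    rw [neg_mul, Complex.exp_neg, Complex.exp_pi_mul_I]; norm_num
  have : (1 : ℂ) - q * -1 = ((1 + q : ℝ) : ℂ) := by push_cast; ring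
  rw [logKernel, Complex.log_im, e2, this, Complex.arg_ofReal_of_nonneg (by linarith)]

lemma scherk_angle {m q : ℝ} (hq0 : 0 ≤ q) (hq1 : q < 1) (hm0 : 0 ≤ m) (hm1 : m < 1) :
    Real.arccos m + 2 * (logKernel (Real.arccos m) q).im - π / 2 =
      Real.arcsin ((2 * q / (1 + q ^ 2) - m) / (1 - m * (2 * q / (1 + q ^ 2)))) := by
  have hcos : Real.cos (Real.arccos m) = m := Real.cos_arccos (by linarith) hm1.le
  have hτ0 : 0 < Real.arccos m := Real.arccos_pos.mpr hm1
  have hτπ : Real.arccos m ≤ π / 2 := Real.arccos_le_pi_div_two.mpr hm0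
  set τ := Real.arccos m with hτ
  have hq : ‖(q : ℂ)‖ < 1 := by rwa [Complex.norm_real, Real.norm_eq_abs, abs_of_nonneg hq0]
  have b1 := logKernel_im_sub_lt hτ0 hq
  have b2 := logKernel_im_sub_lt (a := τ) (b := π) (by linarith [Real.pi_pos]) hq
  rw [logKernel_zero_im hq1.le] at b1
  rw [logKernel_pi_im (by linarith)] at b2
  have hθ : (logKernel τ q).im = (1 - q * Complex.exp (-τ * Complex.I)).arg := by
    rw [logKernel, Complex.log_im]
  set θ := (logKernel τ q).im with hθd
  set X : ℂ := 1 - q * Complex.exp (-τ * Complex.I) with hX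
  have hXre : X.re = 1 - q * m := by
    have : (-τ * Complex.I : ℂ) = ((-τ : ℝ) : ℂ) * Complex.I := by push_cast; ring
    rw [hX, this, Complex.sub_re, Complex.re_ofReal_mul, Complex.exp_ofReal_mul_I_re,
      Real.cos_neg, hcos, Complex.one_re]
  have hXim : X.im = q * Real.sin τ := by
    have : (-τ * Complex.I : ℂ) = ((-τ : ℝ) : ℂ) * Complex.I := by push_cast; ring
    rw [hX, this, Complex.sub_im, Complex.im_ofReal_mul, Complex.exp_ofReal_mul_I_im,
      Real.sin_neg, Complex.one_im]
    ring
  have hst : Real.sin τ ^ 2 = 1 - m ^ 2 := by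
    have := Real.sin_sq_add_cos_sq τ
    rw [hcos] at this; linarith
  have hXn : ‖X‖ ^ 2 = 1 - 2 * m * q + q ^ 2 := by
    rw [← Complex.normSq_eq_norm_sq, Complex.normSq_apply, hXre, hXim]
    linear_combination q ^ 2 * hst
  have hXpos : 0 < 1 - 2 * m * q + q ^ 2 := by nlinarith [mul_nonneg hm0 hq0]
  have hX0 : X ≠ 0 := one_sub_mul_exp_ne_zero τ hq
  have hc : ‖X‖ * Real.cos θ = 1 - q * m := by rw [hθ, Complex.norm_mul_cos_arg, hXre]
  have hs : ‖X‖ * Real.sin θ = q * Real.sin τ := by rw [hθ, Complex.norm_mul_sin_arg, hXim]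
  symm
  refine Real.arcsin_eq_of_sin_eq ?_ ⟨by linarith, by linarith⟩
  have e1 : Real.sin (τ + 2 * θ - π / 2) = -Real.cos (τ + 2 * θ) := Real.sin_sub_pi_div_two _
  have e2 : (1 - 2 * m * q + q ^ 2) * Real.cos (τ + 2 * θ) = m * (1 + q ^ 2) - 2 * q := by
    rw [Real.cos_add, Real.cos_two_mul', Real.sin_two_mul, hcos, ← hXn]
    have : ‖X‖ ^ 2 * (m * (Real.cos θ ^ 2 - Real.sin θ ^ 2) -
      Real.sin τ * (2 * Real.sin θ * Real.cos θ)) =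
      m * ((‖X‖ * Real.cos θ) ^ 2 - (‖X‖ * Real.sin θ) ^ 2) -
      Real.sin τ * (2 * (‖X‖ * Real.sin θ) * (‖X‖ * Real.cos θ)) := by ring
    rw [this, hc, hs]
    linear_combination (-m * q ^ 2 - 2 * q * (1 - q * m)) * hst
  have hxm : 1 - m * (2 * q / (1 + q ^ 2)) = (1 - 2 * m * q + q ^ 2) / (1 + q ^ 2) := by
    field_simp; ring
  rw [e1, hxm, eq_div_iff (by positivity)]
  field_simp
  linarith [e2]

lemma scherk_inequality {m x : ℝ} (hm0 : 0 ≤ m) (hmx : 3 * m ≤ 2 * x) (hx1 : x < 1) :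
    (2 - m ^ 2) * (1 - m * x) ^ 2 ≤ 2 * (1 - m ^ 2) ^ 3 := by
  have hm : m ≤ 2 / 3 := by linarith
  have h7 : 1 - m * x ≤ 1 - 3 / 2 * m ^ 2 := by nlinarith
  have h8 : (1 - m * x) ^ 2 ≤ (1 - 3 / 2 * m ^ 2) ^ 2 :=
    pow_le_pow_left₀ (by nlinarith) h7 2
  have hy : m ^ 2 ≤ 4 / 9 := by nlinarith
  have hy0 : 0 ≤ m ^ 2 := sq_nonneg m
  have h9 := mul_le_mul_of_nonneg_left h8 (by linarith : 0 ≤ 2 - m ^ 2)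
  refine h9.trans ?_
  generalize m ^ 2 = y at *
  have h10 : 0 ≤ 1 - 1.5 * y + 0.25 * y ^ 2 := by nlinarith
  linarith [mul_nonneg hy0 h10]

/-- For each `q₀` there is a harmonic map of the unit disk with dilatation `-q²` into a
quadrilateral inscribed in the unit circle that vanishes at `q₀` and has large derivative there. -/
lemma exists_scherk {q₀ : ℝ} (hq0 : 0 ≤ q₀) (hq1 : q₀ < 1) :
    ∃ (A B A' : ℂ → ℂ) (c r : ℝ), c < 1 ∧ (∀ q : ℂ, ‖q‖ < 1 → HasDerivAt A (A' q) q) ∧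
      (∀ q : ℂ, ‖q‖ < 1 → HasDerivAt B (-q ^ 2 * A' q) q) ∧
      (∀ q : ℂ, ‖q‖ < 1 → ‖A q + conj (B q)‖ ≤ 1) ∧
      (∀ q : ℂ, ‖q‖ < 1 → (A q + conj (B q)).re ≤ c) ∧
      A q₀ + conj (B q₀) = 0 ∧ A' q₀ = r ∧ 2 * √2 / π ≤ r * (1 - q₀ ^ 4) := by
  set x := 2 * q₀ / (1 + q₀ ^ 2) with hx
  have hx0 : 0 ≤ x := by positivity
  have hx1 : x < 1 := by rw [hx, div_lt_one (by positivity)]; nlinarith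
  obtain ⟨m, hm0, hmx, hm⟩ := exists_scherk_parameter hx0 hx1
  have hm1 : m < 1 := by linarith
  set s := √(1 - m ^ 2) with hs
  have hs0 : 0 < s := Real.sqrt_pos.mpr (by nlinarith)
  have hs2 : s ^ 2 = 1 - m ^ 2 := Real.sq_sqrt (by nlinarith)
  set N := √(1 + s ^ 2) with hN
  have hN2 : N ^ 2 = 1 + s ^ 2 := Real.sq_sqrt (by positivity)
  have hN0 : 0 < N := Real.sqrt_pos.mpr (by positivity)
  set τ := Real.arccos m with hτ
  have hτ0 : 0 < τ := Real.arccos_pos.mpr hm1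
  have hτπ : τ < π := by
    have := Real.arccos_le_pi_div_two.mpr hm0
    linarith [Real.pi_pos]
  have hcos : Real.cos τ = m := Real.cos_arccos (by linarith) hm1.le
  have hsin : Real.sin τ = s := Real.sin_arccos m
  let V₁ : ℂ := ⟨(s ^ 2 - m) / N, s * (1 + m) / N⟩
  let V₂ : ℂ := ⟨-(m + s ^ 2) / N, s * (1 - m) / N⟩
  have hV₁ : ‖V₁‖ = 1 := by
    rw [← sq_eq_sq₀ (norm_nonneg _) zero_le_one, ← Complex.normSq_eq_norm_sq, Complex.normSq_apply]
    simp only [V₁]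
    field_simp
    rw [hN2]
    linear_combination (s ^ 2 + 1) * hs2
  have hV₂ : ‖V₂‖ = 1 := by
    rw [← sq_eq_sq₀ (norm_nonneg _) zero_le_one, ← Complex.normSq_eq_norm_sq, Complex.normSq_apply]
    simp only [V₂]
    field_simp
    rw [hN2]
    linear_combination (s ^ 2 + 1) * hs2
  have hV : V₂.re ≤ V₁.re := by
    simp only [V₁, V₂]
    gcongr
    nlinarith
  have hE : Complex.exp (τ * Complex.I) = m + s * Complex.I := by
    rw [Complex.exp_mul_I, ← Complex.ofReal_cos, ← Complex.ofReal_sin, hcos, hsin]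
  have hE' : Complex.exp (-τ * Complex.I) = m - s * Complex.I := by
    have : (-τ * Complex.I : ℂ) = ((-τ : ℝ) : ℂ) * Complex.I := by push_cast; ring
    rw [this, Complex.exp_mul_I, ← Complex.ofReal_cos, ← Complex.ofReal_sin, Real.cos_neg,
      Real.sin_neg, hcos, hsin]
    push_cast; ring
  have hsC : (s : ℂ) ^ 2 = 1 - m ^ 2 := by exact_mod_cast hs2
  have hNC : (N : ℂ) ≠ 0 := by exact_mod_cast hN0.ne'
  have hπC : (π : ℂ) ≠ 0 := by exact_mod_cast Real.pi_ne_zero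
  have hV₁e : V₁ = (s ^ 2 - m + s * (1 + m) * Complex.I) / N := by
    apply Complex.ext <;> simp [V₁, Complex.div_ofReal_re, Complex.div_ofReal_im, ← Complex.ofReal_pow]
  have hV₁e' : conj V₁ = (s ^ 2 - m - s * (1 + m) * Complex.I) / N := by
    rw [hV₁e]; simp [sub_eq_add_neg]
  have hV₂e : V₂ = (-(m + s ^ 2) + s * (1 - m) * Complex.I) / N := by
    apply Complex.ext <;> simp [V₂, Complex.div_ofReal_re, Complex.div_ofReal_im, ← Complex.ofReal_pow]
  have hV₂e' : conj V₂ = (-(m + s ^ 2) - s * (1 - m) * Complex.I) / N := by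
    rw [hV₂e]; simp [sub_eq_add_neg]
  have hquad : ∀ q : ℂ, (1 - q * (m - s * Complex.I)) * (1 - q * (m + s * Complex.I)) =
      1 - 2 * m * q + q ^ 2 := fun q => by
    linear_combination q ^ 2 * hsC - q ^ 2 * s ^ 2 * Complex.I_sq
  have hne : ∀ q : ℂ, ‖q‖ < 1 → (1 - q ^ 2) * (1 - 2 * m * q + q ^ 2) ≠ 0 := fun q hq => by
    have h0 := one_sub_mul_exp_ne_zero 0 hq
    have h1 := one_sub_mul_exp_ne_zero τ hq
    have h2 := one_sub_mul_exp_ne_zero (-τ) hq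
    have h3 := one_sub_mul_exp_ne_zero (-π) hq
    simp only [Complex.ofReal_neg, neg_neg, Complex.ofReal_zero, neg_zero, zero_mul, hE, hE',
      Complex.exp_zero, Complex.exp_pi_mul_I, mul_one, mul_neg, sub_neg_eq_add] at *
    have : 1 - q ^ 2 = (1 - q) * (1 + q) := by ring
    rw [← hquad, this]
    exact mul_ne_zero (mul_ne_zero h0 h3) (mul_ne_zero h1 h2)
  have hder : ∀ q : ℂ, ‖q‖ < 1 → HasDerivAt (scherkMap τ V₁ V₂)
      ((4 * s ^ 3 / (π * N) : ℝ) / ((1 - q ^ 2) * (1 - 2 * m * q + q ^ 2))) q := by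
    intro q hq
    refine (hasDerivAt_scherkMap τ V₁ V₂ hq).congr_deriv ?_
    have hD := hne q hq
    rw [hE, hE', hquad, hV₁e', hV₂e', hV₁e, hV₂e]
    generalize (1 - q ^ 2) * (1 - 2 * m * q + q ^ 2) = D at *
    have hI := Complex.I_ne_zero
    have hI2 := Complex.I_sq
    push_cast
    field_simp
    clear hD
    grind only
  have hder' : ∀ q : ℂ, ‖q‖ < 1 → HasDerivAt (scherkMap τ (conj V₁) (conj V₂))
      (-q ^ 2 * ((4 * s ^ 3 / (π * N) : ℝ) / ((1 - q ^ 2) * (1 - 2 * m * q + q ^ 2)))) q := by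
    intro q hq
    refine (hasDerivAt_scherkMap τ (conj V₁) (conj V₂) hq).congr_deriv ?_
    have hD := hne q hq
    rw [hE, hE', hquad, Complex.conj_conj, Complex.conj_conj, hV₁e', hV₂e', hV₁e, hV₂e]
    generalize (1 - q ^ 2) * (1 - 2 * m * q + q ^ 2) = D at *
    have hI := Complex.I_ne_zero
    have hI2 := Complex.I_sq
    push_cast
    field_simp
    clear hD
    grind only
  refine ⟨scherkMap τ V₁ V₂, scherkMap τ (conj V₁) (conj V₂), _, V₁.re,
    (4 * s ^ 3 / (π * N)) / ((1 - q₀ ^ 2) * (1 - 2 * m * q₀ + q₀ ^ 2)), ?_, hder, hder',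
    fun q hq => norm_scherkMap_le hτ0 hτπ hq hV₁ hV₂,
    fun q hq => re_scherkMap_le hτπ hq hV, ?_, by push_cast; rfl, ?_⟩
  · simp only [V₁]
    rw [div_lt_one hN0]
    nlinarith
  · have hqn : ‖(q₀ : ℂ)‖ < 1 := by rwa [Complex.norm_real, Real.norm_eq_abs, abs_of_nonneg hq0]
    have hang := scherk_angle hq0 hq1 hm0 hm1
    rw [← hτ, ← hx] at hang
    rw [← hang, ← hs2] at hm
    rw [scherkMap_add_conj]
    simp only [arcMeasure_re, logKernel_neg_pi, logKernel_im_neg τ hqn, logKernel_zero_im hq1.le,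
      logKernel_pi_im (by linarith : -1 ≤ q₀)]
    generalize (logKernel τ q₀).im = θ at *
    have hmπ : m * π = s ^ 2 * (2 * (τ + 2 * θ - π / 2)) := by
      have := Real.pi_ne_zero
      field_simp at hm
      linarith
    apply Complex.ext
    · simp only [Complex.add_re, Complex.re_ofReal_mul, Complex.conj_re, V₁, V₂, Complex.zero_re]
      have := Real.pi_ne_zero
      field_simp
      linear_combination (-2) * hmπ
    · simp only [Complex.add_im, Complex.im_ofReal_mul, Complex.conj_im, V₁, V₂, Complex.zero_im]
      ring
  · have hmx' : 1 - m * x = (1 - 2 * m * q₀ + q₀ ^ 2) / (1 + q₀ ^ 2) := by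
      rw [hx]; field_simp; ring
    have hpos : 0 < 1 - m * x := by nlinarith
    have hpos' : 0 < 1 - 2 * m * q₀ + q₀ ^ 2 := by nlinarith [mul_nonneg hm0 hq0]
    have h1q : 0 < 1 - q₀ ^ 2 := by nlinarith
    have hval : 4 * s ^ 3 / (π * N) / ((1 - q₀ ^ 2) * (1 - 2 * m * q₀ + q₀ ^ 2)) * (1 - q₀ ^ 4) =
        4 * s ^ 3 / (π * N) / (1 - m * x) := by
      rw [hmx']
      have : 1 - q₀ ^ 4 = (1 - q₀ ^ 2) * (1 + q₀ ^ 2) := by ring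
      rw [this]
      field_simp
    rw [hval, div_div, div_le_div_iff₀ Real.pi_pos (by positivity)]
    have hroot : √2 * (N * (1 - m * x)) ≤ 2 * s ^ 3 := by
      refine abs_le_of_sq_le_sq' ?_ (by positivity) |>.2
      rw [mul_pow, mul_pow, Real.sq_sqrt zero_le_two, hN2]
      have h6 : (2 * s ^ 3) ^ 2 = 4 * (1 - m ^ 2) ^ 3 := by rw [← hs2]; ring
      rw [h6, hs2]
      linarith [scherk_inequality hm0 hmx hx1]
    have := mul_le_mul_of_nonneg_left hroot Real.pi_pos.le
    linarith

/-- The area element of the graph of a function with gradient `(a, b)`. -/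
noncomputable def areaElt (a b : ℝ) : ℝ := √(1 + a ^ 2 + b ^ 2)

lemma areaElt_sq (a b : ℝ) : areaElt a b ^ 2 = 1 + a ^ 2 + b ^ 2 := Real.sq_sqrt (by positivity)

lemma one_le_areaElt (a b : ℝ) : 1 ≤ areaElt a b :=
  Real.one_le_sqrt.mpr (by nlinarith [sq_nonneg a, sq_nonneg b])

lemma areaElt_pos (a b : ℝ) : 0 < areaElt a b := one_pos.trans_le (one_le_areaElt a b)

/-- The stereographic projection of the (conjugate) Gauss map of a graph with gradient `(a, b)`. -/
noncomputable def gaussMap (a b : ℝ) : ℂ := (a - b * Complex.I) / (1 + areaElt a b : ℝ)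

lemma gaussMap_sq_mul_conj (a b : ℝ) : gaussMap a b * conj (gaussMap a b) =
    ((areaElt a b - 1) / (areaElt a b + 1) : ℝ) := by
  have h := areaElt_sq a b
  have h0 := areaElt_pos a b
  rw [Complex.mul_conj, Complex.ofReal_inj, gaussMap, Complex.normSq_div, Complex.normSq_ofReal,
    div_eq_div_iff (by positivity) (by positivity), Complex.normSq_apply]
  simp
  linear_combination (-(areaElt a b + 1)) * h

lemma norm_gaussMap_lt_one (a b : ℝ) : ‖gaussMap a b‖ < 1 := by
  have h := gaussMap_sq_mul_conj a b
  have h0 := areaElt_pos a b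
  rw [Complex.mul_conj, Complex.ofReal_inj, Complex.normSq_eq_norm_sq] at h
  have : (areaElt a b - 1) / (areaElt a b + 1) < 1 := by
    rw [div_lt_one (by positivity)]; linarith
  rw [← h] at this
  exact (sq_lt_one_iff₀ (norm_nonneg _)).mp this

/-- The differential of the isothermal coordinate of a minimal graph with gradient `(a, b)`. -/
noncomputable def lewyForm (a b : ℝ) : ℂ →L[ℝ] ℂ :=
  Complex.reCLM.smulRight (⟨1 + (1 + a ^ 2) * (areaElt a b)⁻¹, a * b * (areaElt a b)⁻¹⟩ : ℂ) +
    Complex.imCLM.smulRight (⟨a * b * (areaElt a b)⁻¹, 1 + (1 + b ^ 2) * (areaElt a b)⁻¹⟩ : ℂ)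

lemma lewyForm_apply (a b : ℝ) (v : ℂ) : lewyForm a b v =
    ((areaElt a b + 1) ^ 2 / (2 * areaElt a b) : ℝ) * (v + conj (gaussMap a b ^ 2 * v)) := by
  have h := areaElt_sq a b
  have h0 := areaElt_pos a b
  have hg : gaussMap a b ^ 2 = ((a ^ 2 - b ^ 2 : ℝ) - (2 * a * b : ℝ) * Complex.I) /
      ((1 + areaElt a b) ^ 2 : ℝ) := by
    rw [gaussMap, div_pow]
    push_cast
    congr 1
    linear_combination b ^ 2 * Complex.I_sq
  rw [hg, lewyForm]
  generalize areaElt a b = W at *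
  have h1 : W + 1 ≠ 0 := by positivity
  have h2 : 1 + W ≠ 0 := by positivity
  apply Complex.ext
  · simp only [add_apply, ContinuousLinearMap.smulRight_apply, Complex.add_re, Complex.real_smul,
      Complex.reCLM_apply, Complex.imCLM_apply, Complex.conj_re,
      Complex.mul_re, Complex.div_ofReal_re, Complex.div_ofReal_im, Complex.sub_re, Complex.sub_im,
      Complex.ofReal_re, Complex.ofReal_im, Complex.I_re, Complex.I_im, Complex.mul_im]
    field_simp
    grind
  · simp only [add_apply, ContinuousLinearMap.smulRight_apply, Complex.add_im, Complex.real_smul,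
      Complex.reCLM_apply, Complex.imCLM_apply, Complex.conj_im,
      Complex.mul_re, Complex.div_ofReal_re, Complex.div_ofReal_im, Complex.sub_re, Complex.sub_im,
      Complex.ofReal_re, Complex.ofReal_im, Complex.I_re, Complex.I_im, Complex.mul_im]
    field_simp
    grind

/-- The inverse of `lewyForm`. -/
noncomputable def lewyInv (a b : ℝ) : ℂ →L[ℝ] ℂ :=
  (1 / 2 : ℝ) • (ContinuousLinearMap.id ℝ ℂ -
    Complex.conjCLE.toContinuousLinearMap.comp (ContinuousLinearMap.mul ℝ ℂ (gaussMap a b ^ 2)))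

lemma lewyInv_apply (a b : ℝ) (v : ℂ) :
    lewyInv a b v = (v - conj (gaussMap a b ^ 2 * v)) / 2 := by
  simp [lewyInv]
  ring

lemma lewy_const (a b : ℝ) : (((areaElt a b + 1) ^ 2 / (2 * areaElt a b) : ℝ) : ℂ) *
    (1 - (gaussMap a b * conj (gaussMap a b)) ^ 2) = 2 := by
  have h0 := areaElt_pos a b
  rw [gaussMap_sq_mul_conj]
  norm_cast
  field_simp
  ring

lemma lewyInv_lewyForm (a b : ℝ) (v : ℂ) : lewyInv a b (lewyForm a b v) = v := by
  rw [lewyInv_apply, lewyForm_apply]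
  simp only [map_mul, map_add, map_pow, Complex.conj_conj, Complex.conj_ofReal]
  linear_combination (v / 2) * lewy_const a b

lemma lewyForm_lewyInv (a b : ℝ) (v : ℂ) : lewyForm a b (lewyInv a b v) = v := by
  rw [lewyForm_apply, lewyInv_apply]
  simp only [map_mul, map_sub, map_div₀, map_pow, Complex.conj_conj, Complex.conj_ofNat]
  linear_combination (v / 2) * lewy_const a b

/-- `lewyForm` as a continuous linear equivalence. -/
noncomputable def lewyEquiv (a b : ℝ) : ℂ ≃L[ℝ] ℂ :=
  ContinuousLinearEquiv.equivOfInverse (lewyForm a b) (lewyInv a b) (lewyInv_lewyForm a b)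
    (lewyForm_lewyInv a b)

lemma normSq_le_re_lewyForm (a b : ℝ) (v : ℂ) :
    Complex.normSq v ≤ (lewyForm a b v * conj v).re := by
  have h0 := areaElt_pos a b
  have : (lewyForm a b v * conj v).re - Complex.normSq v =
      (v.re ^ 2 + v.im ^ 2 + (a * v.re + b * v.im) ^ 2) * (areaElt a b)⁻¹ := by
    rw [Complex.normSq_apply]
    simp [lewyForm]
    ring
  have h2 : 0 ≤ (v.re ^ 2 + v.im ^ 2 + (a * v.re + b * v.im) ^ 2) * (areaElt a b)⁻¹ := by
    positivity
  linarith

/-- `(a, b)` is the gradient, and `r, s, t` are the second derivatives, of a solution of the minimal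
surface equation on the unit disk. -/
structure MinimalGradient (a b r s t : ℂ → ℝ) : Prop where
  hasFDerivAt_left : ∀ w ∈ Metric.ball (0 : ℂ) 1,
    HasFDerivAt a (r w • Complex.reCLM + s w • Complex.imCLM) w
  hasFDerivAt_right : ∀ w ∈ Metric.ball (0 : ℂ) 1,
    HasFDerivAt b (s w • Complex.reCLM + t w • Complex.imCLM) w
  equation : ∀ w ∈ Metric.ball (0 : ℂ) 1,
    (1 + b w ^ 2) * r w - 2 * a w * b w * s w + (1 + a w ^ 2) * t w = 0

lemma HasFDerivAt.areaElt {a b : ℂ → ℝ} {a' b' : ℂ →L[ℝ] ℝ} {w : ℂ} (ha : HasFDerivAt a a' w)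
    (hb : HasFDerivAt b b' w) : HasFDerivAt (fun w => areaElt (a w) (b w))
      ((areaElt (a w) (b w))⁻¹ • (a w • a' + b w • b')) w := by
  have h : HasFDerivAt (fun w => 1 + a w ^ 2 + b w ^ 2)
      ((2 : ℝ) • (a w • a' + b w • b')) w := by
    refine (((ha.pow 2).const_add 1).add (hb.pow 2)).congr_fderiv ?_
    ext; simp; ring
  refine (h.sqrt (by positivity)).congr_fderiv ?_
  have := areaElt_pos (a w) (b w)
  rw [_root_.areaElt] at *
  rw [smul_smul]
  congr 1
  field_simp

lemma HasFDerivAt.areaElt_inv {a b : ℂ → ℝ} {a' b' : ℂ →L[ℝ] ℝ} {w : ℂ} (ha : HasFDerivAt a a' w)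
    (hb : HasFDerivAt b b' w) : HasFDerivAt (fun w => (_root_.areaElt (a w) (b w))⁻¹)
      (-(_root_.areaElt (a w) (b w) ^ 3)⁻¹ • (a w • a' + b w • b')) w := by
  have h0 := areaElt_pos (a w) (b w)
  refine ((hasDerivAt_inv h0.ne').comp_hasFDerivAt w (ha.areaElt hb)).congr_fderiv ?_
  rw [smul_smul]
  congr 1
  field_simp

lemma hasDerivAt_of_hasFDerivAt_mul {f : ℂ → ℂ} {L : ℂ →L[ℝ] ℂ} {z c : ℂ}
    (h : HasFDerivAt f L z) (hL : ∀ u, L u = c * u) : HasDerivAt f c z := by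
  rw [hasDerivAt_iff_hasFDerivAt]
  refine hasFDerivAt_of_restrictScalars ℝ h ?_
  ext u; simp [hL, mul_comm]

/-- The form `(p dx + m dy) + i (m dx + n dy)` is closed when `p_y = m_x` and `m_y = n_x`. -/
lemma fderiv_symmetric_form {p m n : ℂ → ℝ} {w : ℂ} {p₁ c d n₂ : ℝ}
    (hp : HasFDerivAt p (p₁ • Complex.reCLM + c • Complex.imCLM) w)
    (hm : HasFDerivAt m (c • Complex.reCLM + d • Complex.imCLM) w)
    (hn : HasFDerivAt n (d • Complex.reCLM + n₂ • Complex.imCLM) w) {ω : ℂ → ℂ →L[ℝ] ℂ}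
    (hω : ∀ x, ω x = Complex.reCLM.smulRight (⟨p x, m x⟩ : ℂ) +
      Complex.imCLM.smulRight (⟨m x, n x⟩ : ℂ)) :
    DifferentiableAt ℝ ω w ∧ ∀ u v, fderiv ℝ ω w u v = fderiv ℝ ω w v u := by
  have hC : ∀ x y : ℝ, (⟨x, y⟩ : ℂ) = x • (1 : ℂ) + y • Complex.I := fun x y => by
    apply Complex.ext <;> simp
  have hP := (hp.smul_const (1 : ℂ)).add (hm.smul_const Complex.I)
  have hR := (hm.smul_const (1 : ℂ)).add (hn.smul_const Complex.I)
  have hd := ((ContinuousLinearMap.smulRightL ℝ ℂ ℂ Complex.reCLM).hasFDerivAt.comp w hP).add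
    ((ContinuousLinearMap.smulRightL ℝ ℂ ℂ Complex.imCLM).hasFDerivAt.comp w hR)
  have hd' : HasFDerivAt ω _ w :=
    hd.congr_of_eventuallyEq (Eventually.of_forall fun x => by
      rw [hω, hC, hC]
      rfl)
  refine ⟨hd'.differentiableAt, fun u v => ?_⟩
  rw [hd'.fderiv]
  apply Complex.ext <;> simp <;> ring

namespace MinimalGradient

variable {a b r s t : ℂ → ℝ}

lemma fderiv_lewyForm (h : MinimalGradient a b r s t) {w : ℂ} (hw : w ∈ Metric.ball (0 : ℂ) 1) :
    DifferentiableAt ℝ (fun w => lewyForm (a w) (b w)) w ∧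
      ∀ u v, fderiv ℝ (fun w => lewyForm (a w) (b w)) w u v =
        fderiv ℝ (fun w => lewyForm (a w) (b w)) w v u := by
  have ha := h.hasFDerivAt_left w hw
  have hb := h.hasFDerivAt_right w hw
  have hi := ha.areaElt_inv hb
  have hp := (((ha.pow 2).const_add 1).mul hi).const_add 1
  have hn := (((hb.pow 2).const_add 1).mul hi).const_add 1
  have hm := (ha.mul hb).mul hi
  have hW := areaElt_sq (a w) (b w)
  have hW0 := areaElt_pos (a w) (b w)
  have he := h.equation w hw
  refine fderiv_symmetric_form
    (p₁ := 2 * a w * r w * (areaElt (a w) (b w))⁻¹ -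
      (1 + a w ^ 2) * (a w * r w + b w * s w) * (areaElt (a w) (b w) ^ 3)⁻¹)
    (c := 2 * a w * s w * (areaElt (a w) (b w))⁻¹ -
      (1 + a w ^ 2) * (a w * s w + b w * t w) * (areaElt (a w) (b w) ^ 3)⁻¹)
    (d := 2 * b w * s w * (areaElt (a w) (b w))⁻¹ -
      (1 + b w ^ 2) * (a w * r w + b w * s w) * (areaElt (a w) (b w) ^ 3)⁻¹)
    (n₂ := 2 * b w * t w * (areaElt (a w) (b w))⁻¹ -
      (1 + b w ^ 2) * (a w * s w + b w * t w) * (areaElt (a w) (b w) ^ 3)⁻¹)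
    (hp.congr_fderiv ?_) (hm.congr_fderiv ?_) (hn.congr_fderiv ?_) fun x => rfl
  · apply ContinuousLinearMap.ext
    intro u
    simp
    ring
  · apply ContinuousLinearMap.ext
    intro u
    simp only [Pi.mul_apply]
    generalize areaElt (a w) (b w) = W at *
    generalize a w = a at *
    generalize b w = b at *
    clear hp hn hm hi ha hb
    simp
    field_simp
    linear_combination ((-a * s w + b * r w) * u.re + (a * t w - b * s w) * u.im) * hW + (b * u.re + a * u.im) * he
  · apply ContinuousLinearMap.ext
    intro u
    simp
    ring

end MinimalGradient

/-- The derivative of `gaussMap` at `(a, b)` in the direction `(x, y)`. -/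
noncomputable def gaussDeriv (a b x y : ℝ) : ℂ :=
  (x - y * Complex.I) / (1 + areaElt a b : ℝ) -
    (a - b * Complex.I) * ((a * x + b * y) / (areaElt a b * (1 + areaElt a b) ^ 2) : ℝ)

lemma exists_hasFDerivAt_gaussMap {a b : ℂ → ℝ} {a' b' : ℂ →L[ℝ] ℝ} {w : ℂ}
    (ha : HasFDerivAt a a' w) (hb : HasFDerivAt b b' w) :
    ∃ L : ℂ →L[ℝ] ℂ, HasFDerivAt (fun w => gaussMap (a w) (b w)) L w ∧
      ∀ v, L v = gaussDeriv (a w) (b w) (a' v) (b' v) := by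
  have h0 := areaElt_pos (a w) (b w)
  have h1 : (1 + areaElt (a w) (b w)) ≠ 0 := by positivity
  have hi := (hasDerivAt_inv h1).comp_hasFDerivAt w ((ha.areaElt hb).const_add 1)
  have hN := (Complex.ofRealCLM.hasFDerivAt.comp w ha).sub
    ((Complex.ofRealCLM.hasFDerivAt.comp w hb).mul_const Complex.I)
  have hq := hN.mul (Complex.ofRealCLM.hasFDerivAt.comp w hi)
  have hfun : (fun w => gaussMap (a w) (b w)) = fun w => ((a w : ℂ) - b w * Complex.I) *
      (((1 + areaElt (a w) (b w))⁻¹ : ℝ) : ℂ) := by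
    funext x; rw [gaussMap, div_eq_mul_inv]; push_cast; ring
  rw [hfun]
  refine ⟨_, hq, fun v => ?_⟩
  have h0C : ((areaElt (a w) (b w) : ℝ) : ℂ) ≠ 0 := by exact_mod_cast h0.ne'
  have h1C : (1 + (areaElt (a w) (b w) : ℝ) : ℂ) ≠ 0 := by exact_mod_cast h1
  simp [gaussDeriv]
  field_simp
  ring

lemma gaussDeriv_eq_mul_lewyForm {a b r s t : ℝ}
    (he : (1 + b ^ 2) * r - 2 * a * b * s + (1 + a ^ 2) * t = 0) :
    ∃ κ : ℂ, ∀ v : ℂ, gaussDeriv a b (r * v.re + s * v.im) (s * v.re + t * v.im) =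
      κ * lewyForm a b v := by
  have hW := areaElt_sq a b
  have h0 := areaElt_pos a b
  set P := lewyForm a b 1 with hP
  set R := lewyForm a b Complex.I with hR
  have hPv : P = ⟨1 + (1 + a ^ 2) * (areaElt a b)⁻¹, a * b * (areaElt a b)⁻¹⟩ := by
    simp [hP, lewyForm]
  have hRv : R = ⟨a * b * (areaElt a b)⁻¹, 1 + (1 + b ^ 2) * (areaElt a b)⁻¹⟩ := by
    simp [hR, lewyForm]
  have hP0 : P ≠ 0 := fun hh => by
    have h2 := congrArg Complex.re hh
    rw [hPv] at h2
    simp only [Complex.zero_re] at h2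
    have : 0 < 1 + (1 + a ^ 2) * (areaElt a b)⁻¹ := by positivity
    linarith
  have key : gaussDeriv a b s t * P = gaussDeriv a b r s * R := by
    have hg : ∀ x y : ℝ, gaussDeriv a b x y = ⟨x / (1 + areaElt a b) -
        a * ((a * x + b * y) / (areaElt a b * (1 + areaElt a b) ^ 2)), -(y / (1 + areaElt a b)) +
        b * ((a * x + b * y) / (areaElt a b * (1 + areaElt a b) ^ 2))⟩ := fun x y => by
      apply Complex.ext
      · simp only [gaussDeriv, Complex.sub_re, Complex.div_ofReal_re, Complex.re_mul_ofReal]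
        simp
      · simp only [gaussDeriv, Complex.sub_im, Complex.div_ofReal_im, Complex.im_mul_ofReal]
        simp
        ring
    rw [hg, hg, hPv, hRv]
    generalize areaElt a b = W at *
    apply Complex.ext
    · simp only [Complex.mul_re]
      field_simp
      grind
    · simp only [Complex.mul_im]
      field_simp
      grind
  refine ⟨gaussDeriv a b r s / P, fun v => ?_⟩
  have e1 : gaussDeriv a b (r * v.re + s * v.im) (s * v.re + t * v.im) =
      v.re * gaussDeriv a b r s + v.im * gaussDeriv a b s t := by
    simp only [gaussDeriv]
    push_cast
    ring
  have e2 : lewyForm a b v = v.re * P + v.im * R := by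
    rw [hPv, hRv]
    simp [lewyForm]
  rw [e1, e2]
  field_simp
  linear_combination v.im * key

lemma norm_sub_le_of_hasFDerivAt_lewyForm {Z : ℂ → ℂ} {a b : ℂ → ℝ} {s : Set ℂ}
    (hs : Convex ℝ s) (hZ : ∀ w ∈ s, HasFDerivAt Z (lewyForm (a w) (b w)) w) {x y : ℂ}
    (hx : x ∈ s) (hy : y ∈ s) : ‖y - x‖ ≤ ‖Z y - Z x‖ := by
  have hmem : ∀ t ∈ Icc (0 : ℝ) 1, x + t • (y - x) ∈ s := fun t ht =>
    hs.add_smul_sub_mem hx hy ht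
  have hd : ∀ t ∈ Icc (0 : ℝ) 1, HasDerivAt
      (fun t : ℝ => (Z (x + t • (y - x)) * conj (y - x)).re)
      (lewyForm (a (x + t • (y - x))) (b (x + t • (y - x))) (y - x) * conj (y - x)).re t := by
    intro t ht
    have hline : HasDerivAt (fun t : ℝ => x + t • (y - x)) (y - x) t := by
      simpa using ((hasDerivAt_id t).smul_const (y - x)).const_add x
    have := ((hZ _ (hmem t ht)).comp_hasDerivAt t hline).mul_const (conj (y - x))
    exact Complex.reCLM.hasFDerivAt.comp_hasDerivAt t this
  obtain ⟨t, ht, hslope⟩ := exists_hasDerivAt_eq_slope _ _ one_pos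
    (fun t ht => (hd t ht).continuousAt.continuousWithinAt)
    (fun t ht => hd t (Ioo_subset_Icc_self ht))
  have h1 := normSq_le_re_lewyForm (a (x + t • (y - x))) (b (x + t • (y - x))) (y - x)
  rw [hslope] at h1
  simp only [one_smul, zero_smul, add_zero, sub_zero, div_one, add_sub_cancel] at h1
  rw [← Complex.sub_re, ← sub_mul, Complex.normSq_eq_norm_sq] at h1
  have h2 := (Complex.re_le_norm ((Z y - Z x) * conj (y - x)))
  rw [norm_mul, RCLike.norm_conj] at h2
  by_contra! hlt
  nlinarith [norm_nonneg (Z y - Z x), norm_nonneg (y - x)]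

namespace MinimalGradient

variable {a b r s t : ℂ → ℝ}

/-- A minimal graph over the unit disk has a global isothermal coordinate `Z` in which the
projection to the disk is `ζ ↦ ζ / 2 + conj (K ζ)` and the Gauss map `Q` is holomorphic. -/
theorem exists_isothermal (h : MinimalGradient a b r s t) :
    ∃ (Z Q K : ℂ → ℂ) (Ω : Set ℂ), IsOpen Ω ∧ IsPreconnected Ω ∧
      ContinuousOn Z (Metric.ball 0 1) ∧ DifferentiableAt ℝ Z 0 ∧
      (∀ x ∈ Metric.ball (0 : ℂ) 1, Z x ∈ Ω) ∧
      (∀ x ∈ Metric.ball (0 : ℂ) 1, Z x / 2 + conj (K (Z x)) = x) ∧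
      (∀ ζ ∈ Ω, Z (ζ / 2 + conj (K ζ)) = ζ) ∧
      (∀ ζ ∈ Ω, ζ / 2 + conj (K ζ) ∈ Metric.ball (0 : ℂ) 1) ∧
      DifferentiableOn ℂ Q Ω ∧ DilatationOn Q (fun ζ => ζ / 2) K Ω ∧
      (∀ x ∈ Metric.ball (0 : ℂ) 1, Q (Z x) = gaussMap (a x) (b x)) ∧
      ∀ v : ℂ, deriv Q (Z 0) * lewyForm (a 0) (b 0) v =
        gaussDeriv (a 0) (b 0) (r 0 * v.re + s 0 * v.im) (s 0 * v.re + t 0 * v.im) := by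
  set D := Metric.ball (0 : ℂ) 1
  have hDo : IsOpen D := Metric.isOpen_ball
  have hDc : Convex ℝ D := convex_ball _ _
  have h0D : (0 : ℂ) ∈ D := Metric.mem_ball_self one_pos
  obtain ⟨Z, hZ⟩ := hDc.exists_forall_hasFDerivAt_of_fderiv_symmetric hDo
    (fun w hw => (h.fderiv_lewyForm hw).1.differentiableWithinAt)
    (fun w hw => (h.fderiv_lewyForm hw).2)
  have hexp : ∀ x ∈ D, ∀ y ∈ D, ‖y - x‖ ≤ ‖Z y - Z x‖ := fun x hx y hy =>
    norm_sub_le_of_hasFDerivAt_lewyForm hDc hZ hx hy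
  have hinj : InjOn Z D := fun x hx y hy hxy => by
    have := hexp y hy x hx
    rw [hxy, sub_self, norm_zero] at this
    exact sub_eq_zero.mp (norm_le_zero_iff.mp this)
  have hcont : ContinuousOn Z D := fun w hw => (hZ w hw).continuousAt.continuousWithinAt
  have hopen : IsOpen (Z '' D) := by
    rw [isOpen_iff_mem_nhds]
    rintro _ ⟨w, hw, rfl⟩
    have hst : HasStrictFDerivAt Z (lewyEquiv (a w) (b w) : ℂ →L[ℝ] ℂ) w :=
      hasStrictFDerivAt_of_hasFDerivAt_of_continuousAt
        (mem_of_superset (hDo.mem_nhds hw) hZ)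
        (h.fderiv_lewyForm hw).1.continuousAt
    rw [← hst.map_nhds_eq_of_equiv]
    exact image_mem_map (hDo.mem_nhds hw)
  set wf := Function.invFunOn Z D
  have hleft : ∀ x ∈ D, wf (Z x) = x := fun x hx => hinj.leftInvOn_invFunOn hx
  have hmaps : ∀ ζ ∈ Z '' D, wf ζ ∈ D := by
    rintro _ ⟨w, hw, rfl⟩
    rwa [hleft w hw]
  have hright : ∀ ζ ∈ Z '' D, Z (wf ζ) = ζ := by
    rintro _ ⟨w, hw, rfl⟩
    rw [hleft w hw]
  have hwfc : ContinuousOn wf (Z '' D) := by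
    refine LipschitzOnWith.continuousOn (K := 1) (LipschitzOnWith.of_dist_le_mul ?_)
    intro x hx y hy
    have := hexp _ (hmaps y hy) _ (hmaps x hx)
    rw [hright x hx, hright y hy] at this
    simpa [dist_eq_norm] using this
  have hwf : ∀ ζ ∈ Z '' D, HasFDerivAt wf (lewyInv (a (wf ζ)) (b (wf ζ))) ζ := by
    intro ζ hζ
    have hZ' : HasFDerivAt Z (lewyEquiv (a (wf ζ)) (b (wf ζ)) : ℂ →L[ℝ] ℂ) (wf ζ) :=
      hZ _ (hmaps ζ hζ)
    exact HasFDerivAt.of_local_left_inverse (hwfc.continuousAt (hopen.mem_nhds hζ)) hZ'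
      (mem_of_superset (hopen.mem_nhds hζ) hright)
  have hQ : ∀ ζ ∈ Z '' D, ∃ κ, HasDerivAt (fun ζ => gaussMap (a (wf ζ)) (b (wf ζ))) κ ζ ∧
      ∀ v : ℂ, κ * lewyForm (a (wf ζ)) (b (wf ζ)) v =
        gaussDeriv (a (wf ζ)) (b (wf ζ)) (r (wf ζ) * v.re + s (wf ζ) * v.im)
          (s (wf ζ) * v.re + t (wf ζ) * v.im) := by
    intro ζ hζ
    have hm := hmaps ζ hζ
    obtain ⟨κ, hκ⟩ := gaussDeriv_eq_mul_lewyForm (h.equation _ hm)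
    obtain ⟨L, hL, hLv⟩ := exists_hasFDerivAt_gaussMap (h.hasFDerivAt_left _ hm)
      (h.hasFDerivAt_right _ hm)
    refine ⟨κ, ?_, fun v => (hκ v).symm⟩
    refine hasDerivAt_of_hasFDerivAt_mul (hL.comp ζ (hwf ζ hζ)) fun u => ?_
    have := hκ (lewyInv (a (wf ζ)) (b (wf ζ)) u)
    rw [lewyForm_lewyInv] at this
    rw [← this, ContinuousLinearMap.comp_apply, hLv]
    simp
  have hK : ∀ ζ ∈ Z '' D, HasDerivAt (fun ζ => conj (wf ζ) - conj ζ / 2)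
      (-(gaussMap (a (wf ζ)) (b (wf ζ))) ^ 2 * (1 / 2)) ζ := by
    intro ζ hζ
    have h1 := Complex.conjCLE.toContinuousLinearMap.hasFDerivAt.comp ζ (hwf ζ hζ)
    have h2 := (Complex.conjCLE.toContinuousLinearMap.hasFDerivAt (x := ζ)).mul_const (2⁻¹ : ℂ)
    refine hasDerivAt_of_hasFDerivAt_mul (f := fun ζ => conj (wf ζ) - conj ζ / 2)
      (h1.sub h2) fun u => ?_
    simp [lewyInv_apply, Complex.conj_ofNat]
    ring
  have hG : ∀ ζ : ℂ, HasDerivAt (fun ζ : ℂ => ζ / 2) (1 / 2) ζ := fun ζ =>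
    (hasDerivAt_id ζ).div_const 2
  have hproj : ∀ ζ, ζ / 2 + conj (conj (wf ζ) - conj ζ / 2) = wf ζ := fun ζ => by
    simp [Complex.conj_ofNat]
  refine ⟨Z, fun ζ => gaussMap (a (wf ζ)) (b (wf ζ)), fun ζ => conj (wf ζ) - conj ζ / 2, Z '' D,
    hopen, (hDc.isPreconnected).image Z hcont, hcont, (hZ 0 h0D).differentiableAt,
    fun x hx => mem_image_of_mem Z hx, fun x hx => ?_, fun ζ hζ => ?_, fun ζ hζ => ?_,
    fun ζ hζ => ?_, ⟨fun ζ _ => (hG ζ).differentiableAt.differentiableWithinAt,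
      fun ζ hζ => (hK ζ hζ).differentiableAt.differentiableWithinAt, fun ζ hζ => ?_⟩,
    fun x hx => ?_, ?_⟩
  · rw [hproj, hleft x hx]
  · rw [hproj, hright ζ hζ]
  · rw [hproj]; exact hmaps ζ hζ
  · obtain ⟨κ, hκ, -⟩ := hQ ζ hζ
    exact hκ.differentiableAt.differentiableWithinAt
  · rw [(hK ζ hζ).deriv, (hG ζ).deriv]
  · simp only [hleft x hx]
  · obtain ⟨κ, hκ, hκv⟩ := hQ (Z 0) (mem_image_of_mem Z h0D)
    rw [hleft 0 h0D] at hκv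
    rw [hκ.deriv]
    exact hκv

end MinimalGradient

namespace MinimalGradient

variable {a b r s t : ℂ → ℝ}

lemma deriv_gaussMap_eq {a b r s t α μ : ℝ} {h κ : ℂ} (hh : Complex.normSq h = 1)
    (ha : a = α * h.im) (hb : b = -(α * h.re)) (hμ₁ : r * h.re + s * h.im = μ * h.re)
    (hμ₂ : s * h.re + t * h.im = μ * h.im)
    (hκ : κ * lewyForm a b h = gaussDeriv a b (r * h.re + s * h.im) (s * h.re + t * h.im)) :
    h ^ 2 * κ = (μ * areaElt a b / (1 + areaElt a b) ^ 2 : ℝ) := by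
  have hW := areaElt_sq a b
  have h0 := areaElt_pos a b
  rw [Complex.normSq_apply] at hh
  have hα : α ^ 2 = areaElt a b ^ 2 - 1 := by rw [hW, ha, hb]; grind
  have hl : lewyForm a b h = ((areaElt a b + 1) / areaElt a b : ℝ) * h := by
    apply Complex.ext
    · simp only [lewyForm, Complex.re_ofReal_mul]
      simp
      field_simp
      grind
    · simp only [lewyForm, Complex.im_ofReal_mul]
      simp
      field_simp
      grind
  have hg : gaussDeriv a b (r * h.re + s * h.im) (s * h.re + t * h.im) =
      (μ / (1 + areaElt a b) : ℝ) * conj h := by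
    have e : a * (μ * h.re) + b * (μ * h.im) = 0 := by rw [ha, hb]; ring
    rw [hμ₁, hμ₂, gaussDeriv, e]
    apply Complex.ext
    · simp only [Complex.sub_re, Complex.div_ofReal_re, Complex.re_mul_ofReal,
        Complex.re_ofReal_mul]
      simp
      ring
    · simp only [Complex.sub_im, Complex.div_ofReal_im, Complex.im_mul_ofReal,
        Complex.im_ofReal_mul]
      simp
      ring
  rw [hl, hg] at hκ
  have hc : h * conj h = 1 := by
    rw [Complex.mul_conj, Complex.normSq_apply, hh]; simp
  generalize areaElt a b = W at *
  have h0C : (W : ℂ) ≠ 0 := by exact_mod_cast h0.ne'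
  have h1C : (1 + W : ℂ) ≠ 0 := by exact_mod_cast (by positivity : (1 + W : ℝ) ≠ 0)
  push_cast at hκ ⊢
  field_simp at hκ ⊢
  linear_combination h * hκ + (μ : ℂ) * W * hc

lemma areaElt_mul_eq {a b α : ℝ} (hα : a ^ 2 + b ^ 2 = α ^ 2) :
    1 - (α / (1 + areaElt a b)) ^ 4 = 4 * (areaElt a b / (1 + areaElt a b) ^ 2) := by
  have hW := areaElt_sq a b
  have h0 := areaElt_pos a b
  have h2 : α ^ 2 = areaElt a b ^ 2 - 1 := by linarith
  generalize areaElt a b = W at *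
  have h4 : α ^ 4 = (W ^ 2 - 1) ^ 2 := by rw [← h2]; ring
  rw [div_pow, h4]
  field_simp
  ring

/-- The bound on the principal second derivative `μ` of a minimal graph over the unit disk whose
gradient at the origin is `α ≥ 0` times `-i h`, where `h` is a principal direction. -/
theorem abs_second_deriv_lt_aux (H : MinimalGradient a b r s t) {h : ℂ} {α μ : ℝ}
    (hh : Complex.normSq h = 1) (hα : 0 ≤ α) (ha : a 0 = α * h.im) (hb : b 0 = -(α * h.re))
    (hμ₁ : r 0 * h.re + s 0 * h.im = μ * h.re) (hμ₂ : s 0 * h.re + t 0 * h.im = μ * h.im) :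
    |μ| < π / √2 := by
  by_contra! hcon
  have hμpos : 0 < |μ| := lt_of_lt_of_le (by positivity) hcon
  obtain ⟨Z, Q, K, Ω, hΩ, hΩc, hZc, hZ0, hZΩ, hwZ, hZw, hw, hQd, hdil, hQZ, hQ'⟩ :=
    H.exists_isothermal
  have h0D : (0 : ℂ) ∈ Metric.ball (0 : ℂ) 1 := Metric.mem_ball_self one_pos
  have hW1 := one_le_areaElt (a 0) (b 0)
  have hW := areaElt_sq (a 0) (b 0)
  have hh' := hh
  rw [Complex.normSq_apply] at hh'
  have hα2 : a 0 ^ 2 + b 0 ^ 2 = α ^ 2 := by rw [ha, hb]; grind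
  set W := areaElt (a 0) (b 0) with hWdef
  have hq1 : α / (1 + W) < 1 := by
    rw [div_lt_one (by positivity)]; nlinarith
  have hq4 := areaElt_mul_eq hα2
  have hκ := deriv_gaussMap_eq hh ha hb hμ₁ hμ₂ (hQ' h)
  rw [← hWdef] at hq4 hκ
  obtain ⟨A, B, A', c, ρ, hc, hA, hB, hle, hre, hzero, hρ, hbound⟩ :=
    exists_scherk (q₀ := α / (1 + W)) (by positivity) hq1
  set n : ℂ := -Complex.I * h with hn
  have hnn : n * conj n = 1 := by
    rw [hn, Complex.mul_conj]; simp [hh]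
  have hnorm : ‖n‖ = 1 := by
    rw [Complex.mul_conj, Complex.normSq_eq_norm_sq] at hnn
    have : ‖n‖ ^ 2 = 1 := by exact_mod_cast hnn
    exact (pow_eq_one_iff_of_nonneg (norm_nonneg _) two_ne_zero).mp this
  have hn2 : n ^ 2 = -h ^ 2 := by rw [hn, mul_pow, neg_sq, Complex.I_sq]; ring
  have hnq : n * Q (Z 0) = (α / (1 + W) : ℝ) := by
    rw [hQZ 0 h0D, gaussMap, ← hWdef, ha, hb, mul_div_assoc', Complex.ofReal_div]
    congr 1
    rw [hn]
    apply Complex.ext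
    · simp; linear_combination α * hh'
    · simp; ring
  obtain ⟨ε, hε, hεμ⟩ : ∃ ε : ℝ, ε * ε = 1 ∧ ε * -μ = |μ| := by
    rcases le_total 0 μ with hp | hp
    · exact ⟨-1, by norm_num, by rw [abs_of_nonneg hp]; ring⟩
    · exact ⟨1, by norm_num, by rw [abs_of_nonpos hp]; ring⟩
  have hQ1 : ∀ ζ ∈ Ω, ‖Q ζ‖ < 1 := fun ζ hζ => by
    rw [← hZw ζ hζ, hQZ _ (hw ζ hζ)]; exact norm_gaussMap_lt_one _ _
  have hnQ : ∀ ζ ∈ Ω, ‖n * Q ζ‖ < 1 := fun ζ hζ => by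
    rw [norm_mul, hnorm, one_mul]; exact hQ1 ζ hζ
  have hQder : ∀ ζ ∈ Ω, HasDerivAt Q (deriv Q ζ) ζ := fun ζ hζ =>
    (hQd.differentiableAt (hΩ.mem_nhds hζ)).hasDerivAt
  have hg : ∀ ζ ∈ Ω, HasDerivAt (fun ζ => ε * n * A (n * Q ζ))
      (ε * n * (A' (n * Q ζ) * (n * deriv Q ζ))) ζ := fun ζ hζ =>
    ((hA _ (hnQ ζ hζ)).comp ζ ((hQder ζ hζ).const_mul n)).const_mul _
  have hk : ∀ ζ ∈ Ω, HasDerivAt (fun ζ => ε * conj n * B (n * Q ζ))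
      (ε * conj n * (-(n * Q ζ) ^ 2 * A' (n * Q ζ) * (n * deriv Q ζ))) ζ := fun ζ hζ =>
    ((hB _ (hnQ ζ hζ)).comp ζ ((hQder ζ hζ).const_mul n)).const_mul _
  have hdil' : DilatationOn Q (fun ζ => ε * n * A (n * Q ζ))
      (fun ζ => ε * conj n * B (n * Q ζ)) Ω :=
    ⟨fun ζ hζ => (hg ζ hζ).differentiableAt.differentiableWithinAt,
      fun ζ hζ => (hk ζ hζ).differentiableAt.differentiableWithinAt, fun ζ hζ => by
        rw [(hg ζ hζ).deriv, (hk ζ hζ).deriv]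
        linear_combination (-ε * n * n * Q ζ ^ 2 * A' (n * Q ζ) * deriv Q ζ) * hnn⟩
  have hT : ∀ q : ℂ, ε * n * A q + conj (ε * conj n * B q) = ε * n * (A q + conj (B q)) := by
    intro q
    simp only [map_mul, Complex.conj_conj, Complex.conj_ofReal]
    ring
  have hεn : ‖(ε : ℂ) * n‖ = 1 := by
    rw [norm_mul, hnorm, mul_one, Complex.norm_real, Real.norm_eq_abs]
    exact (mul_self_eq_one_iff.mp hε).elim (fun e => by simp [e]) (fun e => by simp [e])
  have hZ0Ω := hZΩ 0 h0D
  have hgder : deriv (fun ζ => ε * n * A (n * Q ζ)) (Z 0) =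
      (ρ * (|μ| * (W / (1 + W) ^ 2)) : ℝ) := by
    rw [(hg _ hZ0Ω).deriv, hnq, hρ]
    have : (ε : ℂ) * n * (ρ * (n * deriv Q (Z 0))) = -(ε * ρ * (h ^ 2 * deriv Q (Z 0))) := by
      linear_combination ε * ρ * deriv Q (Z 0) * hn2
    rw [this, hκ, ← hεμ]
    push_cast
    ring
  have hGder : deriv (fun ζ : ℂ => ζ / 2) (Z 0) = 1 / 2 :=
    ((hasDerivAt_id (Z 0)).div_const 2).deriv
  set σ := ρ * (|μ| * (W / (1 + W) ^ 2)) with hσ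
  have hσ2 : 1 / 2 ≤ σ := by
    have e : σ = |μ| * (ρ * (1 - (α / (1 + W)) ^ 4)) / 4 := by rw [hq4, hσ]; ring
    have e2 : π / √2 * (2 * √2 / π) = 2 := by field_simp
    rw [e]
    have := mul_le_mul hcon hbound (by positivity) (abs_nonneg μ)
    linarith
  have hσ0 : 0 < σ := by linarith
  have hmain := hdil.eq_mul_of_le_one hdil' hΩ hΩc hQd hQ1 hZc hZΩ hwZ hZw hw hZ0
    (by rw [hT, hnq, hzero, mul_zero])
    (fun ζ hζ => by rw [hT, norm_mul, hεn, one_mul]; exact hle _ (hnQ ζ hζ))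
    (l := 1 / 2 / σ) (by positivity) (by rw [div_le_one hσ0]; exact hσ2)
    (by rw [hGder]; norm_num)
    (by
      have : (σ : ℂ) ≠ 0 := by exact_mod_cast hσ0.ne'
      rw [hGder, hgder]; push_cast; field_simp)
  set l := 1 / 2 / σ with hl
  have hl1 : l ≤ 1 := by rw [hl, div_le_one hσ0]; exact hσ2
  have hl0 : 0 < l := by positivity
  obtain ⟨x, hx0, hxc, hx1⟩ : ∃ x : ℝ, 0 < x ∧ c < x ∧ x < 1 := by
    obtain ⟨x, hx, hx1⟩ := exists_between (max_lt hc one_pos)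
    exact ⟨x, (le_max_right _ _).trans_lt hx, (le_max_left _ _).trans_lt hx, hx1⟩
  have hxD : (ε : ℂ) * n * x ∈ Metric.ball (0 : ℂ) 1 := by
    rw [mem_ball_zero_iff, norm_mul, hεn, one_mul, Complex.norm_real, Real.norm_eq_abs,
      abs_of_pos hx0]
    exact hx1
  have hval := hmain _ (hZΩ _ hxD)
  rw [hwZ _ hxD, hT] at hval
  have hεn0 : (ε : ℂ) * n ≠ 0 := fun e => by rw [e, norm_zero] at hεn; norm_num at hεn
  have hval' : (x : ℂ) = l * (A (n * Q (Z (ε * n * x))) + conj (B (n * Q (Z (ε * n * x))))) :=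
    mul_left_cancel₀ hεn0 (hval.trans (by ring))
  have hre' := congrArg Complex.re hval'
  rw [Complex.ofReal_re, Complex.re_ofReal_mul] at hre'
  have := hre _ (hnQ _ (hZΩ _ hxD))
  nlinarith

/-- The bound on the principal second derivative `μ` of a minimal graph over the unit disk in a
principal direction `h` orthogonal to the gradient at the origin. -/
theorem abs_second_deriv_lt (H : MinimalGradient a b r s t) {h : ℂ} {μ : ℝ}
    (hh : Complex.normSq h = 1) (hab : a 0 * h.re + b 0 * h.im = 0)
    (hμ₁ : r 0 * h.re + s 0 * h.im = μ * h.re) (hμ₂ : s 0 * h.re + t 0 * h.im = μ * h.im) :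
    |μ| < π / √2 := by
  have hh' := hh
  rw [Complex.normSq_apply] at hh'
  rcases le_total 0 (a 0 * h.im - b 0 * h.re) with hα | hα
  · exact H.abs_second_deriv_lt_aux hh hα (by grind) (by grind) hμ₁ hμ₂
  · refine H.abs_second_deriv_lt_aux (h := -h) (by simpa using hh) (neg_nonneg.mpr hα) ?_ ?_ ?_ ?_
    all_goals simp only [Complex.neg_re, Complex.neg_im]
    all_goals grind

end MinimalGradient

lemma hasFDerivAt_lineDeriv_of_contDiffOn {U : Set (ℝ × ℝ)} {f : ℝ × ℝ → ℝ} {p : ℝ × ℝ}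
    (hU : IsOpen U) (hf : ContDiffOn ℝ 2 f U) (hp : p ∈ U) (v : ℝ × ℝ) :
    HasFDerivAt (fun p => lineDeriv ℝ f p v) ((fderiv ℝ (fderiv ℝ f) p).flip v) p := by
  have h1 : DifferentiableAt ℝ (fderiv ℝ f) p :=
    ((hf.contDiffAt (hU.mem_nhds hp)).fderiv_right (m := 1) (by norm_num)).differentiableAt
      (by norm_num)
  have h2 : HasFDerivAt (fun p => fderiv ℝ f p v) ((fderiv ℝ (fderiv ℝ f) p).flip v) p := by
    simpa using h1.hasFDerivAt.clm_apply (hasFDerivAt_const v p)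
  refine h2.congr_of_eventuallyEq ?_
  filter_upwards [hU.mem_nhds hp] with x hx
  exact ((hf.contDiffAt (hU.mem_nhds hx)).differentiableAt (by norm_num)).lineDeriv_eq_fderiv

lemma isOpen_unitDisk : IsOpen unitDisk :=
  isOpen_lt (by fun_prop) continuous_const

lemma mem_unitDisk_of_mem_ball {w : ℂ} (hw : w ∈ Metric.ball (0 : ℂ) 1) :
    (w.re, w.im) ∈ unitDisk := by
  rw [mem_ball_zero_iff, ← sq_lt_one_iff₀ (norm_nonneg w), ← Complex.normSq_eq_norm_sq,
    Complex.normSq_apply] at hw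
  simpa [unitDisk, sq] using hw

lemma HasFDerivAt.comp_re_im {g : ℝ × ℝ → ℝ} {L : ℝ × ℝ →L[ℝ] ℝ} {w : ℂ}
    (h : HasFDerivAt g L (w.re, w.im)) : HasFDerivAt (fun w : ℂ => g (w.re, w.im))
      (L (1, 0) • Complex.reCLM + L (0, 1) • Complex.imCLM) w := by
  have h1 : HasFDerivAt (fun w : ℂ => g (w.re, w.im))
      (L.comp (Complex.reCLM.prod Complex.imCLM)) w :=
    HasFDerivAt.comp w h (Complex.reCLM.prod Complex.imCLM).hasFDerivAt
  refine h1.congr_fderiv ?_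
  ext v
  have : ((v.re, v.im) : ℝ × ℝ) = v.re • (1, 0) + v.im • (0, 1) := by simp
  simp only [ContinuousLinearMap.comp_apply, ContinuousLinearMap.prod_apply, Complex.reCLM_apply,
    Complex.imCLM_apply, this, map_add, map_smul]
  simp [mul_comm]

lemma fderiv_fderiv_comm_of_contDiffOn {f : ℝ × ℝ → ℝ} {p : ℝ × ℝ}
    (hf : ContDiffOn ℝ 2 f unitDisk) (hp : p ∈ unitDisk)
    (x y : ℝ × ℝ) : fderiv ℝ (fderiv ℝ f) p x y = fderiv ℝ (fderiv ℝ f) p y x :=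
  ((hf.contDiffAt (isOpen_unitDisk.mem_nhds hp)).isSymmSndFDerivAt (by simp)).eq x y

lemma lineDeriv_lineDeriv_of_contDiffOn {f : ℝ × ℝ → ℝ} {p : ℝ × ℝ}
    (hf : ContDiffOn ℝ 2 f unitDisk) (hp : p ∈ unitDisk)
    (x y : ℝ × ℝ) :
    lineDeriv ℝ (fun p => lineDeriv ℝ f p x) p y = fderiv ℝ (fderiv ℝ f) p y x := by
  have h := hasFDerivAt_lineDeriv_of_contDiffOn isOpen_unitDisk hf hp x
  rw [h.differentiableAt.lineDeriv_eq_fderiv, h.fderiv]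
  rfl

lemma minimalGradient_of_minimalSurfaceEq {f : ℝ × ℝ → ℝ} (hf : ContDiffOn ℝ 2 f unitDisk)
    (hmin : MinimalSurfaceEq f unitDisk) :
    MinimalGradient (fun w => pdu f (w.re, w.im)) (fun w => pdv f (w.re, w.im))
      (fun w => pdu (pdu f) (w.re, w.im)) (fun w => pdv (pdu f) (w.re, w.im))
      (fun w => pdv (pdv f) (w.re, w.im)) where
  hasFDerivAt_left w hw := by
    have hp := mem_unitDisk_of_mem_ball hw
    have h := (hasFDerivAt_lineDeriv_of_contDiffOn isOpen_unitDisk hf hp (1, 0)).comp_re_im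
    simp only [ContinuousLinearMap.flip_apply] at h
    rw [← lineDeriv_lineDeriv_of_contDiffOn hf hp, ← lineDeriv_lineDeriv_of_contDiffOn hf hp] at h
    exact h
  hasFDerivAt_right w hw := by
    have hp := mem_unitDisk_of_mem_ball hw
    have h := (hasFDerivAt_lineDeriv_of_contDiffOn isOpen_unitDisk hf hp (0, 1)).comp_re_im
    simp only [ContinuousLinearMap.flip_apply] at h
    rw [fderiv_fderiv_comm_of_contDiffOn hf hp (1, 0), ← lineDeriv_lineDeriv_of_contDiffOn hf hp,
      ← lineDeriv_lineDeriv_of_contDiffOn hf hp] at h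
    exact h
  equation w hw := hmin _ (mem_unitDisk_of_mem_ball hw)

/-- A symmetric point: the gradient at `p` is orthogonal to `h`, and `h` is principal. -/
lemma IsSymmetricPt.eqns {f : ℝ × ℝ → ℝ} {p h : ℝ × ℝ} (hf : ContDiffOn ℝ 2 f unitDisk)
    (hp : p ∈ unitDisk) (hsym : IsSymmetricPt f p h) :
    pdu f p * h.1 + pdv f p * h.2 = 0 ∧
      -h.1 * h.2 * pdu (pdu f) p + (h.1 ^ 2 - h.2 ^ 2) * pdv (pdu f) p +
        h.1 * h.2 * pdv (pdv f) p = 0 := by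
  obtain ⟨-, h1, h2⟩ := hsym
  have hd : DifferentiableAt ℝ f p :=
    (hf.contDiffAt (isOpen_unitDisk.mem_nhds hp)).differentiableAt (by norm_num)
  have eh : h = h.1 • (1, 0) + h.2 • (0, 1) := by ext <;> simp
  have eh' : ((-h.2, h.1) : ℝ × ℝ) = (-h.2) • (1, 0) + h.1 • (0, 1) := by simp
  have eu : pdu f p = fderiv ℝ f p (1, 0) := hd.lineDeriv_eq_fderiv
  have ev : pdv f p = fderiv ℝ f p (0, 1) := hd.lineDeriv_eq_fderiv
  have euu : pdu (pdu f) p = fderiv ℝ (fderiv ℝ f) p (1, 0) (1, 0) :=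
    lineDeriv_lineDeriv_of_contDiffOn hf hp _ _
  have euv : pdv (pdu f) p = fderiv ℝ (fderiv ℝ f) p (0, 1) (1, 0) :=
    lineDeriv_lineDeriv_of_contDiffOn hf hp _ _
  have evv : pdv (pdv f) p = fderiv ℝ (fderiv ℝ f) p (0, 1) (0, 1) :=
    lineDeriv_lineDeriv_of_contDiffOn hf hp _ _
  have hc := fderiv_fderiv_comm_of_contDiffOn hf hp (1, 0) (0, 1)
  rw [hd.lineDeriv_eq_fderiv, eh, map_add, map_smul, map_smul, smul_eq_mul, smul_eq_mul] at h1
  rw [lineDeriv_lineDeriv_of_contDiffOn hf hp, eh', map_add, map_smul, map_smul, add_apply,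
    smul_apply, smul_apply] at h2
  conv at h2 => enter [1]; rw [eh]
  simp only [map_add, map_smul, smul_eq_mul] at h2
  rw [eu, ev, euu, euv, evv]
  exact ⟨by linear_combination h1, by simp at h2; linear_combination h2 + (h.2 ^ 2) * hc⟩

/-- For a minimal graph the Hessian determinant is `-W²` times the square of the second
derivative in a principal direction orthogonal to the gradient. -/
lemma hessian_det_eq {a b r s t x y : ℝ} (hxy : x ^ 2 + y ^ 2 = 1) (hgrad : a * x + b * y = 0)
    (hhess : -x * y * r + (x ^ 2 - y ^ 2) * s + x * y * t = 0)
    (hmse : (1 + b ^ 2) * r - 2 * a * b * s + (1 + a ^ 2) * t = 0) :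
    r * t - s ^ 2 =
      -((1 + a ^ 2 + b ^ 2) * (x ^ 2 * r + 2 * x * y * s + y ^ 2 * t) ^ 2) := by
  obtain ⟨μ, hμ⟩ : ∃ μ, μ = x ^ 2 * r + 2 * x * y * s + y ^ 2 * t := ⟨_, rfl⟩
  obtain ⟨ν, hν⟩ : ∃ ν, ν = y ^ 2 * r - 2 * x * y * s + x ^ 2 * t := ⟨_, rfl⟩
  obtain ⟨α, hα⟩ : ∃ α, α = a * y - b * x := ⟨_, rfl⟩
  have ha : a = α * y := by grind
  have hb : b = -(α * x) := by grind
  have hr : r = x ^ 2 * μ + y ^ 2 * ν := by grind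
  have hs : s = x * y * (μ - ν) := by grind
  have ht : t = y ^ 2 * μ + x ^ 2 * ν := by grind
  have h1 : ν = -((1 + α ^ 2) * μ) := by
    rw [ha, hb, hr, hs, ht] at hmse
    clear hμ hν hα ha hb hr hs ht hgrad hhess
    grind
  have h2 : r * t - s ^ 2 = μ * ν := by
    clear hμ hν
    grind
  have h3 : 1 + a ^ 2 + b ^ 2 = 1 + α ^ 2 := by
    clear hμ hν
    grind
  rw [← hμ, h2, h3, h1]
  ring

end

/-- **Kalaj, Theorem 3 (normalized curvature bound).**  If `f` is a `C²` solution of the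
minimal surface equation on the unit disk and the point above the origin is symmetric,
then `W² |K| < π²/2` where `W² = 1 + f_u(0,0)² + f_v(0,0)²`. -/
theorem normalized_curvature_lt_of_symmetric (f : ℝ × ℝ → ℝ)
    (hreg : ContDiffOn ℝ 2 f unitDisk)
    (hmin : MinimalSurfaceEq f unitDisk)
    (h : ℝ × ℝ) (hsym : IsSymmetricPt f (0, 0) h) :
    (1 + (pdu f (0, 0)) ^ 2 + (pdv f (0, 0)) ^ 2) * |gaussCurv f (0, 0)|
      < Real.pi ^ 2 / 2 := by
  have h0 : ((0 : ℝ), (0 : ℝ)) ∈ unitDisk := by simp [unitDisk]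
  obtain ⟨hgrad, hhess⟩ := hsym.eqns hreg h0
  have hmse := hmin _ h0
  have hh := hsym.1
  have key := (minimalGradient_of_minimalSurfaceEq hreg hmin).abs_second_deriv_lt (h := ⟨h.1, h.2⟩)
    (μ := h.1 ^ 2 * pdu (pdu f) (0, 0) + 2 * h.1 * h.2 * pdv (pdu f) (0, 0) +
      h.2 ^ 2 * pdv (pdv f) (0, 0)) (by rw [Complex.normSq_apply]; linarith)
    (by simpa using hgrad) (by simp; grind) (by simp; grind)
  have hdet := hessian_det_eq hh hgrad hhess hmse
  have hsq := mul_self_lt_mul_self (abs_nonneg _) key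
  have e : π / √2 * (π / √2) = π ^ 2 / 2 := by
    rw [div_mul_div_comm, Real.mul_self_sqrt zero_le_two, sq]
  rw [abs_mul_abs_self, e] at hsq
  rw [gaussCurv, hdet]
  generalize h.1 ^ 2 * pdu (pdu f) (0, 0) + 2 * h.1 * h.2 * pdv (pdu f) (0, 0) +
      h.2 ^ 2 * pdv (pdv f) (0, 0) = μ at *
  have hW : 0 < 1 + pdu f (0, 0) ^ 2 + pdv f (0, 0) ^ 2 := by positivity
  rw [abs_div, abs_neg, abs_of_nonneg (by positivity), abs_of_pos (by positivity)]
  generalize 1 + pdu f (0, 0) ^ 2 + pdv f (0, 0) ^ 2 = w at *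
  calc w * (w * μ ^ 2 / w ^ 2) = μ * μ := by field_simp
    _ < π ^ 2 / 2 := hsq
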